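/- Suppose k = R, and suppose (W~, S~) is a Coxeter system with W~ ⊆ GL(V~) acting on V~ through its natural reflection representation (so S~ is the set of reflections through the walls of a chamber of W~). Assume G is a good normal subgroup of W~ and let S be the set of non-identity elements of the image of S~ under the quotient map W~ -> W. Then (W, S) is a Coxeter system. -/

import Mathlib

open MvPolynomial

noncomputable section

namespace ReflQuot

variable {k : Type} [Field k]

/-- The action of an invertible matrix `g` on polynomial functions on `k^n`:
the linear form `X i` is sent to `∑ j, (g⁻¹) i j • X j`, so that
`(g • f) (v) = f (g⁻¹ ⬝ v)`. -/
def matAct {n : ℕ} (g : Matrix.GeneralLinearGroup (Fin n) k) :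
    MvPolynomial (Fin n) k →ₐ[k] MvPolynomial (Fin n) k :=
  aeval fun i => ∑ j, ((↑(g⁻¹) : Matrix (Fin n) (Fin n) k) i j) • X j

/-- The algebra endomorphism of `k[X_1,…,X_m]` sending `X i` to `∑ j, M i j • X j`. -/
def polyAct {m : ℕ} (M : Fin m → Fin m → k) :
    MvPolynomial (Fin m) k →ₐ[k] MvPolynomial (Fin m) k :=
  aeval fun i => ∑ j, M i j • X j

/-- A reflection: an automorphism of finite order whose fixed-point subspace is a
hyperplane. -/
def IsReflection {n : ℕ} (M : Matrix (Fin n) (Fin n) k) : Prop :=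
  IsOfFinOrder M ∧
    Module.finrank k (LinearMap.ker (Matrix.toLin' M - LinearMap.id)) + 1 = n

/-- A double reflection: finite order, fixed points of codimension 2. -/
def IsDoubleReflection {n : ℕ} (M : Matrix (Fin n) (Fin n) k) : Prop :=
  IsOfFinOrder M ∧
    Module.finrank k (LinearMap.ker (Matrix.toLin' M - LinearMap.id)) + 2 = n

/-- A reflection group: a group generated by its reflections. -/
def IsReflectionGroup {n : ℕ} (W : Subgroup (Matrix.GeneralLinearGroup (Fin n) k)) : Prop :=
  Subgroup.closure {g | g ∈ W ∧ IsReflection ((g : Matrix (Fin n) (Fin n) k))} = W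

/-- The algebra of `G`-invariant polynomials. -/
def invariants {n : ℕ} (G : Subgroup (Matrix.GeneralLinearGroup (Fin n) k)) :
    Subalgebra k (MvPolynomial (Fin n) k) where
  carrier := {f | ∀ g ∈ G, matAct g f = f}
  mul_mem' := fun {a b} ha hb g hg => by
    rw [map_mul, ha g hg, hb g hg]
  one_mem' := fun g _ => map_one (matAct g)
  add_mem' := fun {a b} ha hb g hg => by
    rw [map_add, ha g hg, hb g hg]
  zero_mem' := fun g _ => map_zero (matAct g)
  algebraMap_mem' := fun r g _ => (matAct g).commutes r

/-- The linear span of products of two positive-degree invariants, i.e. `(B^G_+)^2`. -/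
def sqSpan {n : ℕ} (G : Subgroup (Matrix.GeneralLinearGroup (Fin n) k)) :
    Submodule k (MvPolynomial (Fin n) k) :=
  Submodule.span k {f | ∃ u ∈ invariants G, ∃ v ∈ invariants G,
    constantCoeff u = 0 ∧ constantCoeff v = 0 ∧ f = u * v}

/-- The ideal of positive-degree elements of the polynomial ring. -/
def idealPlus (k : Type) [Field k] (m : ℕ) : Ideal (MvPolynomial (Fin m) k) :=
  Ideal.span (Set.range X)

/-- The ideal `I` of relations between the generators `p i` of the invariant algebra:
the kernel of `k[V] = k[X_1,…,X_m] → B^G`, `X i ↦ p i`. -/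
def relIdeal {n m : ℕ} (p : Fin m → MvPolynomial (Fin n) k) :
    Ideal (MvPolynomial (Fin m) k) :=
  RingHom.ker (aeval p : MvPolynomial (Fin m) k →ₐ[k] MvPolynomial (Fin n) k)

/-- The context: `Wt` is a finite reflection group on `k^n`, `G` a normal subgroup of `Wt`,
`p` a minimal system of homogeneous generators (of degrees `d`) of the invariant algebra
`B^G` whose span is `Wt`-stable (i.e. a graded `W`-equivariant section of
`B^G_+ → B^G_+/(B^G_+)^2`), and `c w` the matrix of the action of `w` on the span of the
`p i`, giving the induced action of `W = Wt/G` on `V = k^m`. -/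
structure QuotSetup {n m : ℕ} (Wt G : Subgroup (Matrix.GeneralLinearGroup (Fin n) k))
    (p : Fin m → MvPolynomial (Fin n) k) (d : Fin m → ℕ)
    (c : ↥Wt → Fin m → Fin m → k) : Prop where
  finite : (Wt : Set (Matrix.GeneralLinearGroup (Fin n) k)).Finite
  reflGroup : IsReflectionGroup Wt
  le : G ≤ Wt
  normal : ∀ w ∈ Wt, ∀ g ∈ G, w * g * w⁻¹ ∈ G
  homog : ∀ i, (p i).IsHomogeneous (d i)
  dpos : ∀ i, 0 < d i
  gen : Algebra.adjoin k (Set.range p) = invariants G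
  minimal : ∀ a : Fin m → k, (∑ i, a i • p i) ∈ sqSpan G → a = 0
  equivar : ∀ (w : ↥Wt) (i), matAct (w : Matrix.GeneralLinearGroup (Fin n) k) (p i)
      = ∑ j, c w i j • p j

/-- `W = Wt/G` acts trivially on the conormal module `I/(A_+ I)`. -/
def TrivialConormal {n m : ℕ} (Wt : Subgroup (Matrix.GeneralLinearGroup (Fin n) k))
    (p : Fin m → MvPolynomial (Fin n) k) (c : ↥Wt → Fin m → Fin m → k) : Prop :=
  ∀ w : ↥Wt, ∀ f ∈ relIdeal p, polyAct (c w) f - f ∈ idealPlus k m * relIdeal p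

/-- `G` is of complete intersection: `I` is generated by `dim V - dim Vt = m - n` elements. -/
def IsCompleteIntersection {n m : ℕ} (p : Fin m → MvPolynomial (Fin n) k) : Prop :=
  ∃ s : Finset (MvPolynomial (Fin m) k), s.card = m - n ∧ Ideal.span (s : Set _) = relIdeal p

/-- `G` is a good normal subgroup of `Wt`. -/
def IsGoodQuot {n m : ℕ} (Wt : Subgroup (Matrix.GeneralLinearGroup (Fin n) k))
    (p : Fin m → MvPolynomial (Fin n) k) (c : ↥Wt → Fin m → Fin m → k) : Prop :=
  IsCompleteIntersection p ∧ TrivialConormal Wt p c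


/-- The pointwise stabilizer of a subspace `L` in `GL_n(k)`. -/
def pointStab {n : ℕ} (L : Submodule k (Fin n → k)) :
    Subgroup (Matrix.GeneralLinearGroup (Fin n) k) where
  carrier := {g | ∀ x ∈ L, Matrix.mulVec (g : Matrix (Fin n) (Fin n) k) x = x}
  one_mem' := fun x _ => Matrix.one_mulVec x
  mul_mem' := fun {a b} ha hb x hx => by
    rw [Units.val_mul, ← Matrix.mulVec_mulVec, hb x hx, ha x hx]
  inv_mem' := fun {a} ha x hx => by
    have h1 : Matrix.mulVec (↑(a⁻¹) : Matrix (Fin n) (Fin n) k)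
        (Matrix.mulVec (↑a : Matrix (Fin n) (Fin n) k) x) = x := by
      rw [Matrix.mulVec_mulVec, ← Units.val_mul, inv_mul_cancel, Units.val_one,
        Matrix.one_mulVec]
    rw [ha x hx] at h1
    exact h1

/-- The set of reflecting hyperplanes of a subgroup `W` of `GL_n(k)`. -/
def reflHyps {n : ℕ} (W : Subgroup (Matrix.GeneralLinearGroup (Fin n) k)) :
    Set (Submodule k (Fin n → k)) :=
  {H | ∃ g ∈ W, IsReflection ((g : Matrix (Fin n) (Fin n) k)) ∧
      H = LinearMap.ker (Matrix.toLin' ((g : Matrix (Fin n) (Fin n) k)) - LinearMap.id)}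

/-- The set `A'(Wt)` of reflecting hyperplanes `H` of `Wt` such that `Wt_H ≠ G_H`. -/
def reflHyps' {n : ℕ} (Wt G : Subgroup (Matrix.GeneralLinearGroup (Fin n) k)) :
    Set (Submodule k (Fin n → k)) :=
  {H | H ∈ reflHyps Wt ∧ ¬ (Wt ⊓ pointStab H ≤ G)}

/-- `Wt_H` and `Wt_{H'}` have the same image in `W = Wt/G`. -/
def imageEq {n : ℕ} (Wt G : Subgroup (Matrix.GeneralLinearGroup (Fin n) k))
    (H H' : Submodule k (Fin n → k)) : Prop :=
  {x | ∃ g ∈ G, ∃ u ∈ Wt ⊓ pointStab H, x = g * u}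
    = {x | ∃ g ∈ G, ∃ u ∈ Wt ⊓ pointStab H', x = g * u}

/-- `e_H = |G_H|`. -/
def eH {n : ℕ} (G : Subgroup (Matrix.GeneralLinearGroup (Fin n) k))
    (H : Submodule k (Fin n → k)) : ℕ :=
  Nat.card ↥(G ⊓ pointStab H)

/-- The map `p : Vt → V`, `x ↦ (p 1 (x), …, p m (x))`. -/
def pMap {n m : ℕ} (p : Fin m → MvPolynomial (Fin n) k) (x : Fin n → k) : Fin m → k :=
  fun i => eval x (p i)

/-- The matrix of the action of (the image in `W` of) `w` on `V = k^m`. -/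
def qMat {n m : ℕ} {Wt : Subgroup (Matrix.GeneralLinearGroup (Fin n) k)}
    (c : ↥Wt → Fin m → Fin m → k) (w : ↥Wt) : Matrix (Fin m) (Fin m) k :=
  Matrix.of (c w⁻¹)

/-- The set of reflecting hyperplanes of `W = Wt/G` acting on `V = k^m`. -/
def reflHypsV {n m : ℕ} {Wt : Subgroup (Matrix.GeneralLinearGroup (Fin n) k)}
    (c : ↥Wt → Fin m → Fin m → k) : Set (Submodule k (Fin m → k)) :=
  {K | ∃ w : ↥Wt, IsReflection (qMat c w) ∧
      K = LinearMap.ker (Matrix.toLin' (qMat c w) - LinearMap.id)}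

/-- The underlying matrix of an element of a subgroup of `GL_n(k)`. -/
def matOf {n : ℕ} {Wt : Subgroup (Matrix.GeneralLinearGroup (Fin n) k)} (w : ↥Wt) :
    Matrix (Fin n) (Fin n) k :=
  ((w : Matrix.GeneralLinearGroup (Fin n) k) : Matrix (Fin n) (Fin n) k)

/-- A cocycle `N : W → (W → ℤ/2)` taking each `s ∈ S` to its indicator function. -/
structure IsInversionCocycle {W : Type*} [Group W] (S : Set W) (N : W → W → ZMod 2) : Prop where
  mul : ∀ x y r, N (x * y) r = N x r + N y (x⁻¹ * r * x)
  simple_self : ∀ s ∈ S, N s s = 1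
  simple_ne : ∀ s ∈ S, ∀ r, r ≠ s → N s r = 0

theorem zmod_two_eq_zero_or_one (a : ZMod 2) : a = 0 ∨ a = 1 := by
  revert a; decide

/-- The smallest length of a word in `S` representing `w`. -/
def wordLen {W : Type*} [Group W] (S : Set W) (w : W) : ℕ :=
  sInf {n | ∃ l : List W, (∀ x ∈ l, x ∈ S) ∧ l.prod = w ∧ l.length = n}

theorem wordLen_prod_le {W : Type*} [Group W] {S : Set W} {l : List W} (hl : ∀ x ∈ l, x ∈ S) :
    wordLen S l.prod ≤ l.length :=
  Nat.sInf_le ⟨l, hl, rfl, rfl⟩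

theorem exists_word_of_closure {W : Type*} [Group W] {S : Set W} (hinv : ∀ s ∈ S, s * s = 1)
    {w : W} (hw : w ∈ Subgroup.closure S) : ∃ l : List W, (∀ x ∈ l, x ∈ S) ∧ l.prod = w := by
  induction hw using Subgroup.closure_induction_left with
  | one => exact ⟨[], by simp, rfl⟩
  | mul_left x hx y _ ih =>
    obtain ⟨l, hl, rfl⟩ := ih
    exact ⟨x :: l, by simpa using ⟨hx, hl⟩, by simp⟩
  | inv_mul_cancel x hx y _ ih =>
    obtain ⟨l, hl, rfl⟩ := ih
    exact ⟨x :: l, by simpa using ⟨hx, hl⟩, by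
      rw [List.prod_cons, inv_eq_of_mul_eq_one_left (hinv x hx)]⟩

theorem exists_word_length_eq {W : Type*} [Group W] {S : Set W} (hinv : ∀ s ∈ S, s * s = 1)
    (hgen : Subgroup.closure S = ⊤) (w : W) :
    ∃ l : List W, (∀ x ∈ l, x ∈ S) ∧ l.prod = w ∧ l.length = wordLen S w := by
  have hne : {n | ∃ l : List W, (∀ x ∈ l, x ∈ S) ∧ l.prod = w ∧ l.length = n}.Nonempty := by
    obtain ⟨l, hl, h⟩ := exists_word_of_closure hinv (w := w) (by rw [hgen]; trivial)
    exact ⟨_, l, hl, h, rfl⟩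
  exact Nat.sInf_mem hne

namespace IsInversionCocycle

variable {W : Type*} [Group W] {S : Set W} {N : W → W → ZMod 2}

theorem one (h : IsInversionCocycle S N) (r : W) : N 1 r = 0 := by
  have := h.mul 1 1 r
  simpa using this

theorem inv (h : IsInversionCocycle S N) (x r : W) : N x⁻¹ r = N x (x * r * x⁻¹) := by
  have := h.mul x⁻¹ x r
  rw [inv_mul_cancel, h.one, inv_inv] at this
  exact CharTwo.add_eq_zero.1 this.symm

theorem conj_self (h : IsInversionCocycle S N) {s : W} (hs : s ∈ S) (v : W) :
    N (v * s * v⁻¹) (v * s * v⁻¹) = 1 := by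
  rw [h.mul, h.mul, h.inv]
  have e1 : v⁻¹ * (v * s * v⁻¹) * v = s := by group
  have e2 : v * ((v * s)⁻¹ * (v * s * v⁻¹) * (v * s)) * v⁻¹ = v * s * v⁻¹ := by group
  rw [e1, e2, h.simple_self s hs, add_right_comm, CharTwo.add_self_eq_zero, zero_add]

/-- The exchange condition. -/
theorem exchange (h : IsInversionCocycle S N) (hinv : ∀ s ∈ S, s * s = 1) :
    ∀ (l : List W), (∀ x ∈ l, x ∈ S) → ∀ r, N l.prod r = 1 →
      ∃ l' : List W, l'.Sublist l ∧ l'.length + 1 = l.length ∧ l'.prod = r * l.prod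
  | [], _, r, hr => by simp [h.one] at hr
  | s :: l, hl, r, hr => by
    have hs : s ∈ S := hl s (by simp)
    by_cases hrs : r = s
    · exact ⟨l, List.sublist_cons_self _ _, rfl, by
        rw [List.prod_cons, ← mul_assoc, hrs, hinv s hs, one_mul]⟩
    · rw [List.prod_cons, h.mul, h.simple_ne s hs r hrs, zero_add] at hr
      obtain ⟨l', h1, h2, h3⟩ := exchange h hinv l (fun x hx => hl x (by simp [hx])) _ hr
      refine ⟨s :: l', h1.cons_cons s, by simp [h2], ?_⟩
      rw [List.prod_cons, h3, List.prod_cons]; group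

theorem wordLen_lt (h : IsInversionCocycle S N) (hinv : ∀ s ∈ S, s * s = 1)
    (hgen : Subgroup.closure S = ⊤) {w r : W} (hr : N w r = 1) :
    wordLen S (r * w) < wordLen S w := by
  obtain ⟨l, hl, rfl, hlen⟩ := exists_word_length_eq hinv hgen w
  obtain ⟨l', h1, h2, h3⟩ := h.exchange hinv l hl r hr
  rw [← h3, ← hlen, ← h2]
  exact Nat.lt_succ_of_le (wordLen_prod_le fun x hx => hl x (h1.subset hx))

theorem lt_wordLen (h : IsInversionCocycle S N) (hinv : ∀ s ∈ S, s * s = 1)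
    (hgen : Subgroup.closure S = ⊤) {w r : W} (hrefl : ∃ v, ∃ s ∈ S, r = v * s * v⁻¹)
    (hr : N w r = 0) : wordLen S w < wordLen S (r * w) := by
  obtain ⟨v, s, hs, rfl⟩ := hrefl
  have h2 : (v * s * v⁻¹) * (v * s * v⁻¹) = 1 := by
    have : (v * s * v⁻¹) * (v * s * v⁻¹) = v * (s * s) * v⁻¹ := by group
    rw [this, hinv s hs]; group
  have := h.wordLen_lt hinv hgen (w := (v * s * v⁻¹) * w) (r := v * s * v⁻¹) (by
    rw [h.mul, h.conj_self hs, inv_mul_cancel, one_mul, hr, add_zero])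
  rwa [← mul_assoc, h2, one_mul] at this

theorem exists_descent (h : IsInversionCocycle S N) (hinv : ∀ s ∈ S, s * s = 1)
    (hgen : Subgroup.closure S = ⊤) {w : W} (hw : w ≠ 1) : ∃ s ∈ S, N w s = 1 := by
  obtain ⟨l, hl, rfl, hlen⟩ := exists_word_length_eq hinv hgen w
  match l, hl, hw, hlen with
  | [], _, hw, _ => simp at hw
  | s :: l, hl, _, hlen =>
    have hs : s ∈ S := hl s (by simp)
    refine ⟨s, hs, (zmod_two_eq_zero_or_one _).resolve_left fun h0 => ?_⟩
    have h1 := h.lt_wordLen hinv hgen ⟨1, s, hs, by simp⟩ h0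
    rw [List.prod_cons, ← mul_assoc, hinv s hs, one_mul] at h1
    have h2 := wordLen_prod_le (S := S) (l := l) fun x hx => hl x (by simp [hx])
    rw [List.prod_cons, List.length_cons] at hlen
    omega

end IsInversionCocycle

theorem zpow_mul_of_involution {Γ : Type*} [Group Γ] {a b : Γ} (ha : a * a = 1) (hb : b * b = 1)
    (i : ℤ) : a * (a * b) ^ i = (a * b) ^ (-i) * a := by
  have hab : a * (a * b) * a⁻¹ = (a * b)⁻¹ := by
    rw [mul_inv_rev, inv_eq_of_mul_eq_one_left ha, inv_eq_of_mul_eq_one_left hb,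
      ← mul_assoc a a b, ha, one_mul]
  have := congrArg (· ^ i) hab
  simp only [conj_zpow, inv_zpow'] at this
  rw [← this]; group

theorem prod_mul_prod_inv_mem_zpowers {Γ : Type*} [Group Γ] {a b : Γ} (ha : a * a = 1)
    (hb : b * b = 1) : ∀ (l₁ l₂ : List Γ), (∀ x ∈ l₁, x = a ∨ x = b) → (∀ x ∈ l₂, x = a ∨ x = b) →
      l₁.length = l₂.length → ∃ i : ℤ, l₁.prod * l₂.prod⁻¹ = (a * b) ^ i
  | [], [], _, _, _ => ⟨0, by simp⟩
  | x :: l₁, y :: l₂, h1, h2, hlen => by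
    obtain ⟨i, hi⟩ := prod_mul_prod_inv_mem_zpowers ha hb l₁ l₂ (fun z hz => h1 z (by simp [hz]))
      (fun z hz => h2 z (by simp [hz])) (by simpa using hlen)
    have hx := h1 x (by simp)
    have hy := h2 y (by simp)
    have ha' : a⁻¹ = a := inv_eq_of_mul_eq_one_left ha
    have hb' : b⁻¹ = b := inv_eq_of_mul_eq_one_left hb
    have key : (x :: l₁).prod * ((y :: l₂).prod)⁻¹ = x * (a * b) ^ i * y⁻¹ := by
      rw [List.prod_cons, List.prod_cons, mul_inv_rev, ← hi]; group
    have hA := zpow_mul_of_involution ha hb i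
    have hB : b = a * (a * b) := by rw [← mul_assoc, ha, one_mul]
    have hbz : b * (a * b) ^ i = (a * b) ^ (-i - 1) * a := by
      have : b * (a * b) ^ i = a * (a * b) ^ (1 + i) := by
        calc b * (a * b) ^ i = a * (a * b) * (a * b) ^ i := by rw [← hB]
          _ = a * (a * b) ^ (1 + i) := by rw [zpow_add, zpow_one, mul_assoc a]
      rw [this, zpow_mul_of_involution ha hb]
      congr 2; ring
    rw [key]
    rcases hx with rfl | rfl <;> rcases hy with rfl | rfl
    · exact ⟨-i, by rw [hA]; group⟩
    · exact ⟨-i + 1, by rw [hA, hb', mul_assoc, zpow_add, zpow_one]⟩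
    · exact ⟨-i - 1, by rw [hbz]; group⟩
    · exact ⟨-i - 1 + 1, by rw [hbz, hb', mul_assoc, zpow_add _ (-i - 1), zpow_one]⟩

/-- The graph of the partial section of `Γ → W` obtained by lifting words that grow at each step. -/
inductive ReducedLift {W Γ : Type*} [Group W] [Group Γ] (S : Set W) (N : W → W → ZMod 2)
    (σ : W → Γ) : W → Γ → Prop
  | one : ReducedLift S N σ 1 1
  | mul {s w : W} {γ : Γ} : s ∈ S → N w s = 0 → ReducedLift S N σ w γ →
      ReducedLift S N σ (s * w) (σ s * γ)

namespace ReducedLift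

variable {W Γ : Type*} [Group W] [Group Γ] {S : Set W} {N : W → W → ZMod 2} {σ : W → Γ}

theorem exists_of_wordLen (h : IsInversionCocycle S N) (hinv : ∀ s ∈ S, s * s = 1)
    (hgen : Subgroup.closure S = ⊤) : ∀ (n : ℕ) (w : W), wordLen S w = n →
      ∃ γ : Γ, ReducedLift S N σ w γ := by
  intro n
  induction n using Nat.strong_induction_on with
  | _ n ih =>
    intro w hw
    by_cases h1 : w = 1
    · subst h1; exact ⟨1, .one⟩
    obtain ⟨s, hs, hsw⟩ := h.exists_descent hinv hgen h1
    obtain ⟨γ, hγ⟩ := ih _ (hw ▸ h.wordLen_lt hinv hgen hsw) (s * w) rfl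
    refine ⟨σ s * γ, ?_⟩
    have := ReducedLift.mul (S := S) (N := N) (σ := σ) hs (w := s * w) (γ := γ) (by
      rw [h.mul, h.simple_self s hs, inv_mul_cancel, one_mul, hsw]; decide) hγ
    rwa [← mul_assoc, hinv s hs, one_mul] at this

/-- Words over `{s, t}` of minimal length in a coset lift. -/
theorem list_prod (h : IsInversionCocycle S N) (hinv : ∀ s ∈ S, s * s = 1)
    {D : Set W} (hD : D ⊆ S) {u : W} {γ : Γ}
    (hu : ∀ v ∈ Subgroup.closure D, ∀ z ∈ D, N u (v⁻¹ * z * v) = 0) (hγ : ReducedLift S N σ u γ) :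
    ∀ l : List W, (∀ x ∈ l, x ∈ D) →
      (∀ l' : List W, (∀ x ∈ l', x ∈ D) → l'.prod = l.prod → l.length ≤ l'.length) →
      ReducedLift S N σ (l.prod * u) ((l.map σ).prod * γ)
  | [], _, _ => by simpa using hγ
  | z :: l, hl, hmin => by
    have hl' : ∀ x ∈ l, x ∈ D := fun x hx => hl x (by simp [hx])
    have hz : z ∈ D := hl z (by simp)
    have ih := list_prod h hinv hD hu hγ l hl' fun l' h1 h2 => by
      simpa using hmin (z :: l') (by simpa using ⟨hz, h1⟩) (by simp [h2])
    rw [List.prod_cons, List.map_cons, List.prod_cons, mul_assoc, mul_assoc]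
    refine .mul (hD hz) ?_ ih
    have hmem : l.prod ∈ Subgroup.closure D :=
      Subgroup.list_prod_mem _ fun x hx => Subgroup.subset_closure (hl' x hx)
    rw [h.mul, hu _ hmem z hz, add_zero]
    refine (zmod_two_eq_zero_or_one _).resolve_right fun h1 => ?_
    obtain ⟨l', a1, a2, a3⟩ := h.exchange hinv l (fun x hx => hD (hl' x hx)) z h1
    have := hmin l' (fun x hx => hl' x (a1.subset hx)) (by rw [a3, List.prod_cons])
    simp at this
    omega

theorem unique (h : IsInversionCocycle S N) (hinv : ∀ s ∈ S, s * s = 1)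
    (hgen : Subgroup.closure S = ⊤) (hσ2 : ∀ s ∈ S, σ s * σ s = 1)
    (hσ : ∀ s ∈ S, ∀ t ∈ S, (σ s * σ t) ^ orderOf (s * t) = 1) :
    ∀ (n : ℕ) (w : W), wordLen S w = n → ∀ γ δ : Γ, ReducedLift S N σ w γ →
      ReducedLift S N σ w δ → γ = δ := by
  intro n
  induction n using Nat.strong_induction_on with
  | _ n ih =>
  intro w hw γ δ hγ hδ
  have hcases : ∀ {w : W} {γ : Γ}, ReducedLift S N σ w γ → (w = 1 ∧ γ = 1) ∨
      ∃ s ∈ S, N w s = 1 ∧ ∃ γ', ReducedLift S N σ (s * w) γ' ∧ γ = σ s * γ' := by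
    rintro _ _ (_ | ⟨hs, h0, hr⟩)
    · exact .inl ⟨rfl, rfl⟩
    · refine .inr ⟨_, hs, ?_, _, ?_, rfl⟩
      · rw [h.mul, h.simple_self _ hs, inv_mul_cancel, one_mul, h0, add_zero]
      · rwa [← mul_assoc, hinv _ hs, one_mul]
  rcases hcases hγ with ⟨rfl, rfl⟩ | ⟨s, hs, hsw, γ', hγ', rfl⟩
  · rcases hcases hδ with ⟨-, rfl⟩ | ⟨t, ht, htw, -⟩
    · rfl
    · simp [h.one] at htw
  rcases hcases hδ with ⟨rfl, -⟩ | ⟨t, ht, htw, δ', hδ', rfl⟩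
  · simp [h.one] at hsw
  have hlts := h.wordLen_lt hinv hgen hsw
  have hltt := h.wordLen_lt hinv hgen htw
  -- a shortest element of the coset of `⟨s, t⟩`
  set D : Set W := {s, t} with hDdef
  have hD : D ⊆ S := by rintro x (rfl | rfl) <;> assumption
  obtain ⟨u, ⟨v, hv, hvu⟩, humin⟩ : ∃ u, (∃ v ∈ Subgroup.closure D, w = v * u) ∧
      ∀ u', (∃ v ∈ Subgroup.closure D, w = v * u') → wordLen S u ≤ wordLen S u' := by
    have hne : {k | ∃ u, (∃ v ∈ Subgroup.closure D, w = v * u) ∧ wordLen S u = k}.Nonempty :=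
      ⟨_, w, ⟨1, one_mem _, by simp⟩, rfl⟩
    obtain ⟨u, hu, hk⟩ := Nat.sInf_mem hne
    exact ⟨u, hu, fun u' hu' => hk ▸ Nat.sInf_le ⟨u', hu', rfl⟩⟩
  have hu : ∀ v' ∈ Subgroup.closure D, ∀ z ∈ D, N u (v'⁻¹ * z * v') = 0 := by
    intro v' hv' z hz
    refine (zmod_two_eq_zero_or_one _).resolve_right fun h1 => ?_
    have hlt := h.wordLen_lt hinv hgen h1
    have hmem : v'⁻¹ * z * v' ∈ Subgroup.closure D :=
      mul_mem (mul_mem (inv_mem hv') (Subgroup.subset_closure hz)) hv'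
    have := humin (v'⁻¹ * z * v' * u) ⟨v * (v'⁻¹ * z * v')⁻¹, mul_mem hv (inv_mem hmem), by
      rw [hvu]; group⟩
    omega
  obtain ⟨η, hη⟩ := exists_of_wordLen (σ := σ) h hinv hgen _ u rfl
  -- lift through words over `D` of minimal length
  obtain ⟨l₀, hl₀, hl₀v⟩ := exists_word_of_closure (fun x hx => hinv x (hD hx)) hv
  obtain ⟨l, ⟨hlD, hlv⟩, hlmin⟩ : ∃ l : List W, ((∀ x ∈ l, x ∈ D) ∧ l.prod = v) ∧
      ∀ l' : List W, (∀ x ∈ l', x ∈ D) → l'.prod = v → l.length ≤ l'.length := by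
    have hne : {k | ∃ l : List W, ((∀ x ∈ l, x ∈ D) ∧ l.prod = v) ∧ l.length = k}.Nonempty :=
      ⟨_, l₀, ⟨hl₀, hl₀v⟩, rfl⟩
    obtain ⟨l, hl, hk⟩ := Nat.sInf_mem hne
    exact ⟨l, hl, fun l' h1 h2 => hk ▸ Nat.sInf_le ⟨l', ⟨h1, h2⟩, rfl⟩⟩
  have key : ∀ x ∈ D, N w x = 1 → ∀ ε, ReducedLift S N σ (x * w) ε → wordLen S (x * w) < n →
      ∃ l' : List W, (∀ y ∈ l', y ∈ D) ∧ l'.length = l.length ∧ l'.prod = v ∧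
        σ x * ε = (l'.map σ).prod * η := by
    intro x hx hxw ε hε hlt
    rw [hvu, h.mul, hu v hv x hx, add_zero, ← hlv] at hxw
    obtain ⟨l', a1, a2, a3⟩ := h.exchange hinv l (fun y hy => hD (hlD y hy)) x hxw
    have hl'D : ∀ y ∈ l', y ∈ D := fun y hy => hlD y (a1.subset hy)
    have hxv : (x :: l').prod = v := by
      rw [List.prod_cons, a3, ← mul_assoc, hinv x (hD hx), one_mul, hlv]
    have := list_prod h hinv hD hu hη l' hl'D fun l'' b1 b2 => by
      have := hlmin (x :: l'') (by simpa using ⟨hx, b1⟩) (by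
        rw [List.prod_cons, b2, ← hxv, List.prod_cons])
      rw [List.length_cons] at this
      omega
    rw [a3, hlv, mul_assoc, ← hvu] at this
    refine ⟨x :: l', by simpa using ⟨hx, hl'D⟩, by simp [a2], hxv, ?_⟩
    rw [ih _ hlt _ rfl _ _ hε this, List.map_cons, List.prod_cons, mul_assoc]
  obtain ⟨l₁, hl₁D, hl₁len, hl₁v, e₁⟩ := key s (by simp [hDdef]) hsw γ' hγ' (hw ▸ hlts)
  obtain ⟨l₂, hl₂D, hl₂len, hl₂v, e₂⟩ := key t (by simp [hDdef]) htw δ' hδ' (hw ▸ hltt)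
  rw [e₁, e₂]
  congr 1
  -- equality inside the dihedral subgroup: compare in `W` and in `Γ` along the same exponent
  have hcmp : ∃ i : ℤ, l₁.prod * l₂.prod⁻¹ = (s * t) ^ i ∧
      (l₁.map σ).prod * ((l₂.map σ).prod)⁻¹ = (σ s * σ t) ^ i := by
    have ha : ((s, σ s) : W × Γ) * (s, σ s) = 1 := Prod.ext (hinv s hs) (hσ2 s hs)
    have hb : ((t, σ t) : W × Γ) * (t, σ t) = 1 := Prod.ext (hinv t ht) (hσ2 t ht)
    have hmem : ∀ l : List W, (∀ y ∈ l, y ∈ D) →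
        ∀ x ∈ l.map (fun y => (y, σ y)), x = (s, σ s) ∨ x = (t, σ t) := by
      intro l hl x hx
      obtain ⟨y, hy, rfl⟩ := List.mem_map.1 hx
      rcases hl y hy with rfl | rfl
      · exact .inl rfl
      · exact .inr rfl
    obtain ⟨i, hi⟩ := prod_mul_prod_inv_mem_zpowers ha hb _ _ (hmem l₁ hl₁D) (hmem l₂ hl₂D)
      (by simp [hl₁len, hl₂len])
    have hfst : ∀ l : List W, ((l.map fun y => (y, σ y)).prod) = (l.prod, (l.map σ).prod) := by
      intro l
      induction l with
      | nil => rfl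
      | cons a l ih => simp [ih]
    rw [hfst, hfst] at hi
    refine ⟨i, ?_, ?_⟩
    · simpa using congrArg Prod.fst hi
    · simpa using congrArg Prod.snd hi
  obtain ⟨i, hi1, hi2⟩ := hcmp
  rw [hl₁v, hl₂v, mul_inv_cancel] at hi1
  obtain ⟨k, rfl⟩ := orderOf_dvd_iff_zpow_eq_one.2 hi1.symm
  rw [zpow_mul, zpow_natCast, hσ s hs t ht, one_zpow] at hi2
  exact mul_inv_eq_one.1 hi2

end ReducedLift

theorem IsInversionCocycle.injective {W Γ : Type*} [Group W] [Group Γ] {S : Set W}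
    {N : W → W → ZMod 2} (h : IsInversionCocycle S N) (hinv : ∀ s ∈ S, s * s = 1)
    (hgen : Subgroup.closure S = ⊤) (σ : W → Γ) (hσ2 : ∀ s ∈ S, σ s * σ s = 1)
    (hσ : ∀ s ∈ S, ∀ t ∈ S, (σ s * σ t) ^ orderOf (s * t) = 1)
    (hσgen : Subgroup.closure (σ '' S) = ⊤) (φ : Γ →* W) (hφ : ∀ s ∈ S, φ (σ s) = s) :
    Function.Injective φ := by
  have huniq := ReducedLift.unique h hinv hgen hσ2 hσ
  have hmul : ∀ s ∈ S, ∀ (w : W) (γ : Γ), ReducedLift S N σ w γ →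
      ReducedLift S N σ (s * w) (σ s * γ) := by
    intro s hs w γ hγ
    rcases zmod_two_eq_zero_or_one (N w s) with h0 | h1
    · exact .mul hs h0 hγ
    · obtain ⟨δ, hδ⟩ := ReducedLift.exists_of_wordLen (σ := σ) h hinv hgen _ (s * w) rfl
      have h2 := ReducedLift.mul (S := S) (N := N) (σ := σ) hs (w := s * w) (γ := δ) (by
        rw [h.mul, h.simple_self s hs, inv_mul_cancel, one_mul, h1]; decide) hδ
      rw [← mul_assoc, hinv s hs, one_mul] at h2
      rwa [huniq _ _ rfl _ _ hγ h2, ← mul_assoc, hσ2 s hs, one_mul]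
  have hall : ∀ γ : Γ, ReducedLift S N σ (φ γ) γ := by
    intro γ
    have hγ : γ ∈ Subgroup.closure (σ '' S) := by rw [hσgen]; trivial
    obtain ⟨l, hl, rfl⟩ := exists_word_of_closure (by rintro _ ⟨s, hs, rfl⟩; exact hσ2 s hs) hγ
    clear hγ
    induction l with
    | nil => simpa using ReducedLift.one
    | cons a l ih =>
      obtain ⟨s, hs, rfl⟩ := hl a (by simp)
      rw [List.prod_cons, map_mul, hφ s hs]
      exact hmul s hs _ _ (ih fun x hx => hl x (by simp [hx]))
  refine (injective_iff_map_eq_one φ).2 fun γ hγ => ?_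
  have := hall γ
  rw [hγ] at this
  exact huniq _ _ rfl _ _ this .one

/-- A group generated by a set `S` of involutions and carrying an inversion cocycle is a Coxeter
group with `S` as its set of simple reflections. -/
theorem IsInversionCocycle.exists_coxeterSystem {W : Type} [Group W] {S : Set W}
    {N : W → W → ZMod 2} (h : IsInversionCocycle S N) (hinv : ∀ s ∈ S, s * s = 1)
    (hgen : Subgroup.closure S = ⊤) :
    ∃ (B : Type) (M : CoxeterMatrix B) (cs : CoxeterSystem M W), Set.range cs.simple = S := by
  classical
  let M : CoxeterMatrix S :=
    { M := fun s t => orderOf ((s : W) * t)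
      isSymm := by
        refine Matrix.IsSymm.ext fun s t => ?_
        rw [← orderOf_inv, mul_inv_rev, inv_eq_of_mul_eq_one_left (hinv _ s.2),
          inv_eq_of_mul_eq_one_left (hinv _ t.2)]
      diagonal := fun s => by rw [hinv _ s.2, orderOf_one]
      off_diagonal := fun s t hst h1 => hst (Subtype.ext (by
        rw [orderOf_eq_one_iff] at h1
        rw [← inv_eq_of_mul_eq_one_left (hinv _ t.2)]
        exact eq_inv_of_mul_eq_one_left h1)) }
  let cΓ := M.toCoxeterSystem
  let φ : M.Group →* W := cΓ.lift ⟨fun s => (s : W), fun s t => pow_orderOf_eq_one _⟩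
  have hφs : ∀ s : S, φ (cΓ.simple s) = s := fun s => cΓ.lift_apply_simple _ s
  let σ : W → M.Group := fun w => if hw : w ∈ S then cΓ.simple ⟨w, hw⟩ else 1
  have hσs : ∀ (s : W) (hs : s ∈ S), σ s = cΓ.simple ⟨s, hs⟩ := fun s hs => dif_pos hs
  have hinj : Function.Injective φ := by
    refine h.injective hinv hgen σ ?_ ?_ ?_ φ ?_
    · intro s hs; rw [hσs s hs]; exact cΓ.simple_mul_simple_self _
    · intro s hs t ht
      rw [hσs s hs, hσs t ht]
      exact cΓ.simple_mul_simple_pow ⟨s, hs⟩ ⟨t, ht⟩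
    · rw [← cΓ.subgroup_closure_range_simple]
      congr 1
      ext x
      constructor
      · rintro ⟨s, hs, rfl⟩; exact ⟨⟨s, hs⟩, (hσs s hs).symm⟩
      · rintro ⟨⟨s, hs⟩, rfl⟩; exact ⟨s, hs, hσs s hs⟩
    · intro s hs; rw [hσs s hs]; exact hφs _
  have hsurj : Function.Surjective φ := by
    rw [← MonoidHom.range_eq_top, eq_top_iff, ← hgen, Subgroup.closure_le]
    intro s hs
    exact ⟨_, hφs ⟨s, hs⟩⟩
  let e : M.Group ≃* W := MulEquiv.ofBijective φ ⟨hinj, hsurj⟩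
  refine ⟨S, M, ⟨e.symm⟩, ?_⟩
  ext x
  constructor
  · rintro ⟨s, rfl⟩
    have : φ (cΓ.simple s) ∈ S := by rw [hφs s]; exact s.2
    exact this
  · intro hx
    exact ⟨⟨x, hx⟩, hφs ⟨x, hx⟩⟩

theorem inv_pow_mul_of_involution {W : Type*} [Group W] {a b : W} (hb : b * b = 1)
    (ha : a * a = 1) (k : ℕ) : ((a * b) ^ k)⁻¹ * b = b * (a * b) ^ k := by
  have h1 : b * (a * b) ^ k * b⁻¹ = ((a * b) ^ k)⁻¹ := by
    rw [← conj_pow, ← inv_pow]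
    congr 1
    rw [mul_inv_rev, inv_eq_of_mul_eq_one_left ha, inv_eq_of_mul_eq_one_left hb, mul_assoc,
      mul_assoc, hb, mul_one]
  rw [← h1]; group

theorem mul_pow_conj_eq_iff {W : Type*} [Group W] {a b : W} (hb : b * b = 1) (ha : a * a = 1)
    (k : ℕ) (t : W) : (a * b) ^ k * t * ((a * b) ^ k)⁻¹ = b ↔ t = b * (a * b) ^ (2 * k) := by
  rw [mul_inv_eq_iff_eq_mul, ← eq_inv_mul_iff_mul_eq, ← mul_assoc,
    inv_pow_mul_of_involution hb ha, two_mul, pow_add, mul_assoc]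

theorem conj_mul_pow_conj_eq_iff {W : Type*} [Group W] {a b : W} (hb : b * b = 1)
    (ha : a * a = 1) (k : ℕ) (t : W) :
    b * ((a * b) ^ k * t * ((a * b) ^ k)⁻¹) * b⁻¹ = a ↔ t = b * (a * b) ^ (2 * k + 1) := by
  rw [mul_inv_eq_iff_eq_mul, ← eq_inv_mul_iff_mul_eq, inv_eq_of_mul_eq_one_left hb,
    mul_inv_eq_iff_eq_mul, ← eq_inv_mul_iff_mul_eq, mul_assoc b, ← mul_assoc _ b,
    inv_pow_mul_of_involution hb ha, mul_assoc b, ← pow_succ', ← pow_add]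
  ring_nf

theorem exists_isInversionCocycle {B W : Type*} [Group W] {M : CoxeterMatrix B}
    (cs : CoxeterSystem M W) : ∃ N, IsInversionCocycle (Set.range cs.simple) N := by
  classical
  have hmul : ∀ (F G : Function.End (W × ZMod 2)) x, (F * G) x = F (G x) := fun _ _ _ => rfl
  let f : B → Function.End (W × ZMod 2) := fun i p =>
    (cs.simple i * p.1 * (cs.simple i)⁻¹, p.2 + if p.1 = cs.simple i then 1 else 0)
  have key : ∀ i j (k : ℕ) (t : W) (ε : ZMod 2), ((f i * f j) ^ k : Function.End (W × ZMod 2)) (t, ε)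
      = ((cs.simple i * cs.simple j) ^ k * t * ((cs.simple i * cs.simple j) ^ k)⁻¹,
        ε + ∑ q ∈ Finset.range (2 * k),
          if t = cs.simple j * (cs.simple i * cs.simple j) ^ q then 1 else 0) := by
    intro i j k t ε
    induction k with
    | zero => simp [Function.End.one_def]
    | succ k ih =>
      have hi := cs.simple_mul_simple_self i
      have hj := cs.simple_mul_simple_self j
      rw [pow_succ', hmul, ih, hmul, mul_add, mul_one,
        Finset.sum_range_succ, Finset.sum_range_succ]
      simp only [← mul_pow_conj_eq_iff hj hi, ← conj_mul_pow_conj_eq_iff hj hi]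
      refine Prod.ext ?_ ?_
      · simp only [f]
        rw [pow_succ', mul_inv_rev, mul_inv_rev]
        simp only [mul_assoc]
      · simp only [f]
        ring
  have hlift : M.IsLiftable f := by
    intro i j
    funext ⟨t, ε⟩
    have h1 := cs.simple_mul_simple_pow i j
    rw [key, h1, two_mul, Finset.sum_range_add]
    simp [pow_add, h1, Function.End.one_def, CharTwo.add_self_eq_zero]
  let Φ := cs.lift ⟨f, hlift⟩
  have hΦ : ∀ i, Φ (cs.simple i) = f i := fun i => cs.lift_apply_simple hlift i
  have hform : ∀ w t (ε : ZMod 2), Φ w (t, ε) = (w * t * w⁻¹, ε + (Φ w (t, 0)).2) := by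
    intro w
    induction w using cs.simple_induction_left with
    | one => intro t ε; simp [Function.End.one_def]
    | mul_simple_left w i ih =>
      intro t ε
      rw [map_mul, hΦ, hmul, hmul, ih, ih t 0]
      simp only [f, zero_add]
      refine Prod.ext ?_ ?_
      · simp only; group
      · simp only; ring
  refine ⟨fun w r => (Φ w⁻¹ (r, 0)).2, ?_, ?_, ?_⟩
  · intro x y r
    rw [mul_inv_rev, map_mul, hmul, hform x⁻¹, hform y⁻¹]
    simp
  · rintro _ ⟨i, rfl⟩
    simp [hΦ, f]
  · rintro _ ⟨i, rfl⟩ r hr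
    simp [hΦ, f, hr]

/-- A faithful orthogonal representation of a group generated by a conjugation-stable set `T` of
elements acting as reflections. -/
structure IsOrthogonalReflectionRep {W V : Type*} [Group W] [AddCommGroup V] [Module ℝ V]
    (π : W →* (V →ₗ[ℝ] V)) (B : V →ₗ[ℝ] V →ₗ[ℝ] ℝ) (T : Set W) : Prop where
  symm : ∀ x y, B x y = B y x
  pos : ∀ x, x ≠ 0 → 0 < B x x
  invariant : ∀ w x y, B (π w x) (π w y) = B x y
  faithful : Function.Injective π
  conj_mem : ∀ t ∈ T, ∀ w, w * t * w⁻¹ ∈ T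
  refl : ∀ t ∈ T, ∃ a, B a a = 2 ∧ ∀ x, π t x = x - B x a • a
  gen : Subgroup.closure T = ⊤

/-- For a reflection `t` with root `a`, this is a positive multiple of `B x a * B y a`; its sign
tells whether `x` and `y` lie on the same side of the mirror of `t`. -/
def sideForm {W V : Type*} [Group W] [AddCommGroup V] [Module ℝ V]
    (π : W →* (V →ₗ[ℝ] V)) (B : V →ₗ[ℝ] V →ₗ[ℝ] ℝ) (t : W) (x y : V) : ℝ :=
  B (x - π t x) (y - π t y)

/-- A vector lying on no mirror. -/
def IsRegularVector {W V : Type*} [Group W] [AddCommGroup V] [Module ℝ V]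
    (π : W →* (V →ₗ[ℝ] V)) (T : Set W) (z : V) : Prop :=
  ∀ t ∈ T, π t z ≠ z

/-- The reflections in the walls of the chamber of `z`. -/
def wallReflections {W V : Type*} [Group W] [AddCommGroup V] [Module ℝ V]
    (π : W →* (V →ₗ[ℝ] V)) (B : V →ₗ[ℝ] V →ₗ[ℝ] ℝ) (T : Set W) (z : V) : Set W :=
  {σ | σ ∈ T ∧ ∀ t ∈ T, t ≠ σ → 0 < sideForm π B t z (π σ z)}

open Classical in
/-- The indicator of the mirrors separating `z` from `w z`. -/
def separates {W V : Type*} [Group W] [AddCommGroup V] [Module ℝ V]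
    (π : W →* (V →ₗ[ℝ] V)) (B : V →ₗ[ℝ] V →ₗ[ℝ] ℝ) (T : Set W) (z : V) (w t : W) : ZMod 2 :=
  if t ∈ T ∧ sideForm π B t z (π w z) < 0 then 1 else 0

/-- The normal vector of the mirror of `t`, normalized to have product `1` with `z`. -/
def normalVec {W V : Type*} [Group W] [AddCommGroup V] [Module ℝ V]
    (π : W →* (V →ₗ[ℝ] V)) (B : V →ₗ[ℝ] V →ₗ[ℝ] ℝ) (z : V) (t : W) : V :=
  (B (z - π t z) z)⁻¹ • (z - π t z)

namespace IsOrthogonalReflectionRep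

variable {W V : Type*} [Group W] [AddCommGroup V] [Module ℝ V] {π : W →* (V →ₗ[ℝ] V)}
  {B : V →ₗ[ℝ] V →ₗ[ℝ] ℝ} {T : Set W}

theorem map_mul_apply (π : W →* (V →ₗ[ℝ] V)) (x y : W) (v : V) : π (x * y) v = π x (π y v) := by
  rw [map_mul]; rfl

theorem map_inv_apply_self (π : W →* (V →ₗ[ℝ] V)) (x : W) (v : V) : π x⁻¹ (π x v) = v := by
  rw [← map_mul_apply, inv_mul_cancel, map_one]; rfl

theorem map_apply_inv_self (π : W →* (V →ₗ[ℝ] V)) (x : W) (v : V) : π x (π x⁻¹ v) = v := by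
  rw [← map_mul_apply, mul_inv_cancel, map_one]; rfl

theorem nonneg (h : IsOrthogonalReflectionRep π B T) (x : V) : 0 ≤ B x x := by
  by_cases hx : x = 0
  · simp [hx]
  · exact (h.pos x hx).le

theorem eq_zero_of_nonpos (h : IsOrthogonalReflectionRep π B T) {x : V} (hx : B x x ≤ 0) :
    x = 0 := by
  by_contra hne
  exact absurd (h.pos x hne) (not_lt.2 hx)

theorem mul_self (h : IsOrthogonalReflectionRep π B T) {t : W} (ht : t ∈ T) : t * t = 1 := by
  obtain ⟨a, ha, hta⟩ := h.refl t ht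
  apply h.faithful
  ext v
  rw [map_mul_apply, hta v, map_sub, map_smul, hta v, hta a, ha, map_one, Module.End.one_apply]
  module

theorem inv_eq (h : IsOrthogonalReflectionRep π B T) {t : W} (ht : t ∈ T) : t⁻¹ = t :=
  inv_eq_of_mul_eq_one_left (h.mul_self ht)

theorem apply_apply (h : IsOrthogonalReflectionRep π B T) {t : W} (ht : t ∈ T) (v : V) :
    π t (π t v) = v := by
  rw [← map_mul_apply, h.mul_self ht, map_one]; rfl

theorem adjoint (h : IsOrthogonalReflectionRep π B T) {t : W} (ht : t ∈ T) (x y : V) :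
    B (π t x) y = B x (π t y) := by
  rw [← h.invariant t, h.apply_apply ht]

theorem sideForm_conj (h : IsOrthogonalReflectionRep π B T) (w t : W) (x y : V) :
    sideForm π B (w * t * w⁻¹) (π w x) (π w y) = sideForm π B t x y := by
  simp only [sideForm, map_mul_apply, map_inv_apply_self, ← map_sub, h.invariant]

theorem sideForm_eq {t : W} {a : V} (ha : B a a = 2) (hta : ∀ x, π t x = x - B x a • a)
    (x y : V) : sideForm π B t x y = 2 * B x a * B y a := by
  simp only [sideForm, hta, sub_sub_cancel, map_smul, LinearMap.smul_apply, ha, smul_eq_mul]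
  ring

theorem sideForm_comm (h : IsOrthogonalReflectionRep π B T) (t : W) (x y : V) :
    sideForm π B t x y = sideForm π B t y x := h.symm _ _

theorem sideForm_mul (h : IsOrthogonalReflectionRep π B T) {t : W} (ht : t ∈ T) (x y z : V) :
    sideForm π B t x y * sideForm π B t y z = sideForm π B t x z * sideForm π B t y y := by
  obtain ⟨a, ha, hta⟩ := h.refl t ht
  simp only [sideForm_eq ha hta]; ring

theorem sideForm_self_pos (h : IsOrthogonalReflectionRep π B T) {t : W} {x : V}
    (hx : π t x ≠ x) : 0 < sideForm π B t x x :=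
  h.pos _ (sub_ne_zero.2 (Ne.symm hx))

theorem sideForm_ne_zero (h : IsOrthogonalReflectionRep π B T) {t : W} (ht : t ∈ T) {x y : V}
    (hx : π t x ≠ x) (hy : π t y ≠ y) : sideForm π B t x y ≠ 0 := by
  intro h0
  have := h.sideForm_mul ht x y x
  rw [h0, zero_mul] at this
  exact (mul_pos (h.sideForm_self_pos hx) (h.sideForm_self_pos hy)).ne this

theorem isRegularVector_apply (h : IsOrthogonalReflectionRep π B T) {z : V}
    (hz : IsRegularVector π T z) (w : W) : IsRegularVector π T (π w z) := by
  intro t ht h0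
  refine hz (w⁻¹ * t * w⁻¹⁻¹) (h.conj_mem t ht w⁻¹) ?_
  rw [inv_inv, map_mul_apply, map_mul_apply, h0, map_inv_apply_self]

theorem exists_isRegularVector [Finite W] (h : IsOrthogonalReflectionRep π B T) :
    ∃ z, IsRegularVector π T z := by
  classical
  have := Fintype.ofFinite W
  let s : Finset (Submodule ℝ V) :=
    (Finset.univ.filter (· ∈ T)).image fun t => LinearMap.ker (π t - 1)
  have hs : ⊤ ∉ s := by
    intro htop
    obtain ⟨t, ht, hk⟩ := Finset.mem_image.1 htop
    obtain ⟨a, ha, hta⟩ := h.refl t (Finset.mem_filter.1 ht).2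
    have : a ∈ LinearMap.ker (π t - 1) := by rw [hk]; trivial
    rw [LinearMap.mem_ker, LinearMap.sub_apply, hta, ha, Module.End.one_apply] at this
    have ha0 : a = 0 := by
      have h2 : (-2 : ℝ) • a = 0 := by rw [← this]; module
      simpa using h2
    simp [ha0] at ha
  have hne := Subspace.biUnion_ne_univ_of_top_notMem hs
  obtain ⟨z, hz⟩ := (Set.ne_univ_iff_exists_notMem _).1 hne
  refine ⟨z, fun t ht h0 => hz ?_⟩
  refine Set.mem_biUnion (x := LinearMap.ker (π t - 1)) ?_ ?_
  · exact Finset.mem_coe.2 (Finset.mem_image.2 ⟨t, by simpa using ht, rfl⟩)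
  · simp [h0]

theorem separates_cocycle (h : IsOrthogonalReflectionRep π B T) {z : V}
    (hz : IsRegularVector π T z) (x y r : W) :
    separates π B T z (x * y) r = separates π B T z x r + separates π B T z y (x⁻¹ * r * x) := by
  have hmem : x⁻¹ * r * x ∈ T ↔ r ∈ T := by
    constructor
    · intro hr
      have := h.conj_mem _ hr x
      rwa [show x * (x⁻¹ * r * x) * x⁻¹ = r by group] at this
    · intro hr
      simpa using h.conj_mem _ hr x⁻¹
  by_cases hr : r ∈ T
  · have e : sideForm π B (x⁻¹ * r * x) z (π y z) = sideForm π B r (π x z) (π (x * y) z) := by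
      rw [← h.sideForm_conj x, ← map_mul_apply]
      congr 1; group
    simp only [separates, hmem, hr, true_and, e]
    have h1 := h.sideForm_mul hr z (π x z) (π (x * y) z)
    have h2 := h.sideForm_self_pos (h.isRegularVector_apply hz x r hr)
    have n1 := h.sideForm_ne_zero hr (hz r hr) (h.isRegularVector_apply hz x r hr)
    have n2 := h.sideForm_ne_zero hr (h.isRegularVector_apply hz x r hr)
      (h.isRegularVector_apply hz (x * y) r hr)
    have n3 := h.sideForm_ne_zero hr (hz r hr) (h.isRegularVector_apply hz (x * y) r hr)
    rcases lt_or_gt_of_ne n1 with a1 | a1 <;> rcases lt_or_gt_of_ne n2 with a2 | a2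
    · rw [if_pos a1, if_pos a2, if_neg (not_lt.2 (by nlinarith [mul_pos_of_neg_of_neg a1 a2]))]
      decide
    · rw [if_pos a1, if_neg a2.not_gt, if_pos (by nlinarith [mul_neg_of_neg_of_pos a1 a2])]
      decide
    · rw [if_neg a1.not_gt, if_pos a2, if_pos (by nlinarith [mul_neg_of_pos_of_neg a1 a2])]
      decide
    · rw [if_neg a1.not_gt, if_neg a2.not_gt,
        if_neg (not_lt.2 (by nlinarith [mul_pos a1 a2]))]
      decide
  · simp [separates, hmem, hr]

theorem separates_isInversionCocycle (h : IsOrthogonalReflectionRep π B T) {z : V}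
    (hz : IsRegularVector π T z) :
    IsInversionCocycle (wallReflections π B T z) (separates π B T z) where
  mul := h.separates_cocycle hz
  simple_self σ hσ := by
    refine if_pos ⟨hσ.1, ?_⟩
    have := h.sideForm_self_pos (hz σ hσ.1)
    have e : sideForm π B σ z (π σ z) = - sideForm π B σ z z := by
      rw [sideForm, sideForm, h.apply_apply hσ.1, ← map_neg, neg_sub]
    rw [e]; exact neg_neg_of_pos this
  simple_ne σ hσ r hr := by
    refine if_neg fun h0 => ?_
    exact (hσ.2 r h0.1 hr).not_gt h0.2

theorem normalVec_eq (h : IsOrthogonalReflectionRep π B T) {z : V} (hz : IsRegularVector π T z)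
    {t : W} (ht : t ∈ T) {a : V} (hta : ∀ x, π t x = x - B x a • a) :
    B z a ≠ 0 ∧ normalVec π B z t = (B z a)⁻¹ • a := by
  have h0 : B z a ≠ 0 := by
    intro h0
    exact hz t ht (by rw [hta, h0, zero_smul, sub_zero])
  refine ⟨h0, ?_⟩
  rw [normalVec, hta, sub_sub_cancel, map_smul, LinearMap.smul_apply, h.symm a z, smul_eq_mul,
    smul_smul]
  congr 1
  field_simp

theorem normalVec_apply (h : IsOrthogonalReflectionRep π B T) {z : V} (hz : IsRegularVector π T z)
    {t : W} (ht : t ∈ T) : B (normalVec π B z t) z = 1 := by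
  obtain ⟨a, ha, hta⟩ := h.refl t ht
  obtain ⟨h0, e⟩ := h.normalVec_eq hz ht hta
  rw [e, map_smul, LinearMap.smul_apply, h.symm a z, smul_eq_mul, inv_mul_cancel₀ h0]

theorem normalVec_self_pos (h : IsOrthogonalReflectionRep π B T) {z : V}
    (hz : IsRegularVector π T z) {t : W} (ht : t ∈ T) :
    0 < B (normalVec π B z t) (normalVec π B z t) := by
  refine h.pos _ fun h0 => ?_
  have := h.normalVec_apply hz ht
  simp [h0] at this

theorem apply_eq_sub (h : IsOrthogonalReflectionRep π B T) {z : V} (hz : IsRegularVector π T z)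
    {t : W} (ht : t ∈ T) (x : V) : π t x = x -
      (2 * B x (normalVec π B z t) / B (normalVec π B z t) (normalVec π B z t)) •
        normalVec π B z t := by
  obtain ⟨a, ha, hta⟩ := h.refl t ht
  obtain ⟨h0, e⟩ := h.normalVec_eq hz ht hta
  rw [e, hta]
  simp only [map_smul, LinearMap.smul_apply, smul_eq_mul, ha, smul_smul]
  congr 2
  field_simp

theorem normalVec_injOn (h : IsOrthogonalReflectionRep π B T) {z : V} (hz : IsRegularVector π T z)
    {t t' : W} (ht : t ∈ T) (ht' : t' ∈ T) (e : normalVec π B z t = normalVec π B z t') :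
    t = t' := by
  apply h.faithful
  ext x
  rw [h.apply_eq_sub hz ht, h.apply_eq_sub hz ht', e]

theorem sideForm_pos_iff (h : IsOrthogonalReflectionRep π B T) {z : V}
    (hz : IsRegularVector π T z) {t : W} (ht : t ∈ T) (y : V) :
    0 < sideForm π B t z y ↔ 0 < B (normalVec π B z t) y := by
  obtain ⟨a, ha, hta⟩ := h.refl t ht
  obtain ⟨h0, e⟩ := h.normalVec_eq hz ht hta
  rw [e, sideForm_eq ha hta, map_smul, LinearMap.smul_apply, h.symm a y, smul_eq_mul]
  have : 2 * B z a * B y a = (2 * (B z a) ^ 2) * ((B z a)⁻¹ * B y a) := by field_simp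
  rw [this]
  exact mul_pos_iff_of_pos_left (by positivity)

theorem apply_normalVec (h : IsOrthogonalReflectionRep π B T) {z : V}
    (hz : IsRegularVector π T z) {t : W} (ht : t ∈ T) (w : W) :
    B (π w (normalVec π B z t)) z ≠ 0 ∧
    π w (normalVec π B z t) =
      B (π w (normalVec π B z t)) z • normalVec π B z (w * t * w⁻¹) := by
  obtain ⟨a, ha, hta⟩ := h.refl t ht
  obtain ⟨h0, e⟩ := h.normalVec_eq hz ht hta
  have hwa : ∀ x, π (w * t * w⁻¹) x = x - B x (π w a) • π w a := by
    intro x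
    have : B (π w⁻¹ x) a = B x (π w a) := by rw [← h.invariant w, map_apply_inv_self]
    rw [map_mul_apply, map_mul_apply, hta, map_sub, map_apply_inv_self, map_smul, this]
  obtain ⟨h1, e1⟩ := h.normalVec_eq hz (h.conj_mem t ht w) hwa
  rw [h.symm] at h1
  rw [e, e1, h.symm z (π w a)]
  simp only [map_smul, LinearMap.smul_apply, smul_eq_mul, smul_smul]
  refine ⟨mul_ne_zero (inv_ne_zero h0) h1, ?_⟩
  congr 1
  field_simp

/-- A linear form positive at some normal vector is positive at the normal vector of a wall. -/
theorem exists_wallReflection_pos [Finite W] (h : IsOrthogonalReflectionRep π B T) {z : V}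
    (hz : IsRegularVector π T z) (f : V →ₗ[ℝ] ℝ) {t : W} (ht : t ∈ T)
    (hft : 0 < f (normalVec π B z t)) :
    ∃ σ ∈ wallReflections π B T z, 0 < f (normalVec π B z σ) := by
  classical
  set e := normalVec π B z with he
  obtain ⟨σ, hσ, hmax⟩ := Set.exists_max_image T (fun t => toLex (f (e t), B (e t) (e t)))
    (Set.toFinite T) ⟨t, ht⟩
  have hmax1 : ∀ b ∈ T, f (e b) ≤ f (e σ) := by
    intro b hb
    rcases Prod.Lex.le_iff.1 (hmax b hb) with h1 | h1
    · exact h1.le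
    · exact h1.1.le
  have hmax2 : ∀ b ∈ T, f (e b) = f (e σ) → B (e b) (e b) ≤ B (e σ) (e σ) := by
    intro b hb hf
    rcases Prod.Lex.le_iff.1 (hmax b hb) with h1 | h1
    · exact absurd hf h1.ne
    · exact h1.2
  refine ⟨σ, ⟨hσ, fun b hb hbσ => ?_⟩, hft.trans_le (hmax1 t ht)⟩
  rw [h.sideForm_pos_iff hz hb, ← h.adjoint hσ]
  obtain ⟨hne, hc⟩ := h.apply_normalVec hz hb σ
  by_contra hneg
  have hneg := lt_of_le_of_ne (not_lt.1 hneg) hne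
  set t' := σ * b * σ⁻¹ with ht'
  have ht'T : t' ∈ T := h.conj_mem b hb σ
  set m := B (π σ (normalVec π B z b)) z with hm
  have h1 := h.apply_eq_sub hz hσ (e b)
  rw [hc] at h1
  set q := 2 * B (e b) (e σ) / B (e σ) (e σ) with hq
  have h2 := congrArg (fun v => B v z) h1
  simp only [map_smul, map_sub, LinearMap.smul_apply, LinearMap.sub_apply, smul_eq_mul,
    h.normalVec_apply hz ht'T, h.normalVec_apply hz hσ, he, h.normalVec_apply hz hb] at h2
  have hqm : q = 1 - m := by linarith
  have h3 : (1 - m) • e σ = e b - m • e t' := by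
    have : e b - m • e t' = e b - (e b - q • e σ) := by rw [← h1]
    rw [this, hqm]; module
  have f3 := congrArg f h3
  simp only [map_smul, map_sub, smul_eq_mul] at f3
  have fb := hmax1 b hb
  have ft' := hmax1 t' ht'T
  have fb' : f (e b) = f (e σ) := by nlinarith
  have ft'' : f (e t') = f (e σ) := by
    have : m * (f (e t') - f (e σ)) = 0 := by nlinarith
    rcases mul_eq_zero.1 this with h0 | h0
    · exact absurd h0 hneg.ne
    · linarith
  have gb := hmax2 b hb fb'
  have gt' := hmax2 t' ht'T ft''
  have g3 := congrArg (fun v => B v (e σ)) h3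
  simp only [map_smul, map_sub, LinearMap.smul_apply, LinearMap.sub_apply, smul_eq_mul] at g3
  have nb : B (e b - e σ) (e b - e σ) = B (e b) (e b) - 2 * B (e b) (e σ) + B (e σ) (e σ) := by
    simp only [map_sub, LinearMap.sub_apply, h.symm (e σ) (e b)]; ring
  have nt : B (e t' - e σ) (e t' - e σ)
      = B (e t') (e t') - 2 * B (e t') (e σ) + B (e σ) (e σ) := by
    simp only [map_sub, LinearMap.sub_apply, h.symm (e σ) (e t')]; ring
  have pt := h.nonneg (e t' - e σ)
  have hle : B (e b - e σ) (e b - e σ) ≤ 0 := by nlinarith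
  exact hbσ (h.normalVec_injOn hz hb hσ (sub_eq_zero.1 (h.eq_zero_of_nonpos hle)))

theorem exists_conj_mem_wallReflections [Finite W] (h : IsOrthogonalReflectionRep π B T) {z : V}
    (hz : IsRegularVector π T z) {t : W} (ht : t ∈ T) :
    ∃ w ∈ Subgroup.closure (wallReflections π B T z), w * t * w⁻¹ ∈ wallReflections π B T z := by
  obtain ⟨w, ⟨hw, hwpos⟩, hmin⟩ := Set.exists_min_image
    {w | w ∈ Subgroup.closure (wallReflections π B T z) ∧ 0 < B (π w (normalVec π B z t)) z}
    (fun w => B (π w (normalVec π B z t)) z) (Set.toFinite _)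
    ⟨1, one_mem _, by simp [h.normalVec_apply hz ht]⟩
  refine ⟨w, hw, ?_⟩
  have ht1 := h.conj_mem t ht w
  obtain ⟨-, hc⟩ := h.apply_normalVec hz ht w
  set β := π w (normalVec π B z t) with hβ
  obtain ⟨σ, hσ, hσpos⟩ := h.exists_wallReflection_pos hz (B β) ht1 (by
    rw [hc, map_smul, LinearMap.smul_apply, smul_eq_mul]
    exact mul_pos hwpos (h.normalVec_self_pos hz ht1))
  by_cases hσt : w * t * w⁻¹ = σ
  · rwa [hσt]
  exfalso
  have h1 := (h.sideForm_pos_iff hz ht1 _).1 (hσ.2 _ ht1 hσt)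
  rw [← h.adjoint hσ.1] at h1
  have h2 : 0 < B (π σ β) z := by
    rw [hc, map_smul, map_smul, LinearMap.smul_apply, smul_eq_mul]
    exact mul_pos hwpos h1
  have h3 := hmin (σ * w) ⟨mul_mem (Subgroup.subset_closure hσ) hw, by
    rwa [map_mul_apply]⟩
  simp only [map_mul_apply] at h3
  rw [← hβ, h.apply_eq_sub hz hσ.1 β, map_sub, map_smul, LinearMap.sub_apply,
    LinearMap.smul_apply, h.normalVec_apply hz hσ.1, smul_eq_mul, mul_one] at h3
  have := h.normalVec_self_pos hz hσ.1
  have : 0 < 2 * B β (normalVec π B z σ) / B (normalVec π B z σ) (normalVec π B z σ) := by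
    positivity
  linarith

theorem closure_wallReflections [Finite W] (h : IsOrthogonalReflectionRep π B T) {z : V}
    (hz : IsRegularVector π T z) : Subgroup.closure (wallReflections π B T z) = ⊤ := by
  rw [eq_top_iff, ← h.gen, Subgroup.closure_le]
  intro t ht
  obtain ⟨w, hw, hwt⟩ := h.exists_conj_mem_wallReflections hz ht
  have := mul_mem (mul_mem (inv_mem hw) (Subgroup.subset_closure hwt)) hw
  rwa [show w⁻¹ * (w * t * w⁻¹) * w = t by group] at this

theorem wallReflections_mul_self (h : IsOrthogonalReflectionRep π B T) {z : V} :
    ∀ σ ∈ wallReflections π B T z, σ * σ = 1 :=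
  fun _ hσ => h.mul_self hσ.1

/-- Stabilizers of vectors are generated by reflections. -/
theorem mem_closure_of_apply_eq [Finite W] (h : IsOrthogonalReflectionRep π B T) {x : V} {w : W}
    (hw : π w x = x) : w ∈ Subgroup.closure {t | t ∈ T ∧ π t x = x} := by
  obtain ⟨c₀, hc₀⟩ := h.exists_isRegularVector
  have hlin : ∀ (t u : W) (ε : ℝ), sideForm π B t x (x + ε • π u c₀)
      = sideForm π B t x x + ε * sideForm π B t x (π u c₀) := by
    intro t u ε
    simp only [sideForm, map_add, map_smul, map_sub, LinearMap.sub_apply, smul_eq_mul]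
    ring
  obtain ⟨ε, hε, hside⟩ : ∃ ε : ℝ, 0 < ε ∧ ∀ t u : W, π t x ≠ x →
      0 < sideForm π B t x (x + ε • π u c₀) := by
    have hev : ∀ᶠ ε : ℝ in nhdsWithin 0 (Set.Ioi 0), ∀ t u : W, π t x ≠ x →
        0 < sideForm π B t x (x + ε • π u c₀) := by
      refine Filter.eventually_all.2 fun t => Filter.eventually_all.2 fun u => ?_
      by_cases hx : π t x = x
      · simp [hx]
      have hcont : Filter.Tendsto (fun ε : ℝ => sideForm π B t x (x + ε • π u c₀))
          (nhdsWithin 0 (Set.Ioi 0)) (nhds (sideForm π B t x x)) := by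
        simp only [hlin]
        have : Continuous fun ε : ℝ =>
            sideForm π B t x x + ε * sideForm π B t x (π u c₀) := by fun_prop
        simpa using (this.tendsto 0).mono_left nhdsWithin_le_nhds
      filter_upwards [hcont.eventually (lt_mem_nhds (h.sideForm_self_pos hx))] with ε hε _
      exact hε
    obtain ⟨ε, h1, h2⟩ := (hev.and self_mem_nhdsWithin).exists
    exact ⟨ε, h2, h1⟩
  set z := x + ε • c₀ with hzdef
  have hside1 : ∀ t, π t x ≠ x → 0 < sideForm π B t x z := by
    intro t ht
    simpa using hside t 1 ht
  have hz : IsRegularVector π T z := by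
    intro t ht h0
    by_cases hx : π t x = x
    · rw [hzdef, map_add, hx, map_smul] at h0
      have := smul_right_injective V hε.ne' (add_left_cancel h0)
      exact hc₀ t ht this
    · have := hside1 t hx
      rw [sideForm, h0, sub_self, map_zero] at this
      exact lt_irrefl _ this
  have hsep : ∀ u t, π u x = x → separates π B T z u t = 1 → t ∈ T ∧ π t x = x := by
    intro u t hu h1
    have h1 : t ∈ T ∧ sideForm π B t z (π u z) < 0 := by
      by_contra hcon
      rw [separates, if_neg hcon] at h1
      exact absurd h1 (by decide)
    refine ⟨h1.1, ?_⟩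
    by_contra hx
    have h2 := h.sideForm_mul h1.1 z x (π u z)
    rw [h.sideForm_comm t z x] at h2
    have h3 := hside1 t hx
    have h4 : 0 < sideForm π B t x (π u z) := by
      rw [hzdef, map_add, hu, map_smul]; exact hside t u hx
    have h5 := h.sideForm_self_pos hx
    nlinarith [mul_pos h3 h4, mul_neg_of_neg_of_pos h1.2 h5]
  have hN := h.separates_isInversionCocycle hz
  have hgen := h.closure_wallReflections hz
  suffices H : ∀ (n : ℕ) (w : W), wordLen (wallReflections π B T z) w = n → π w x = x →
      w ∈ Subgroup.closure {t | t ∈ T ∧ π t x = x} from H _ w rfl hw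
  intro n
  induction n using Nat.strong_induction_on with
  | _ n ih =>
    intro w hn hw
    by_cases h1 : w = 1
    · rw [h1]; exact one_mem _
    obtain ⟨s, hs, hsw⟩ := hN.exists_descent h.wallReflections_mul_self hgen h1
    have hsx := hsep w s hw hsw
    have hlt := hN.wordLen_lt h.wallReflections_mul_self hgen hsw
    have := ih _ (hn ▸ hlt) (s * w) rfl (by rw [map_mul_apply, hw, hsx.2])
    have hs' : s ∈ Subgroup.closure {t | t ∈ T ∧ π t x = x} := Subgroup.subset_closure hsx
    have h2 := mul_mem hs' this
    rwa [← mul_assoc, h.mul_self hsx.1, one_mul] at h2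

end IsOrthogonalReflectionRep

theorem exists_coboundary {W : Type*} [Group W] {T : Set W}
    (hT : ∀ t ∈ T, ∀ w, w * t * w⁻¹ ∈ T) {c : W → W → ZMod 2}
    (hmul : ∀ x y r, c (x * y) r = c x r + c y (x⁻¹ * r * x))
    (hcomm : ∀ t ∈ T, ∀ w, w * t * w⁻¹ = t → c w t = 0) :
    ∃ f : W → ZMod 2, ∀ t ∈ T, ∀ w, c w t = f t + f (w⁻¹ * t * w) := by
  have hrep : ∀ t : W, ∃ v : W, v * (ConjClasses.mk t).out * v⁻¹ = t := fun t =>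
    isConj_iff.1 (ConjClasses.mk_eq_mk_iff_isConj.1 (Quotient.out_eq (ConjClasses.mk t)))
  choose v hv using hrep
  refine ⟨fun t => c (v t) t, fun t ht w => ?_⟩
  set t' := w⁻¹ * t * w with ht'
  have hclass : ConjClasses.mk t' = ConjClasses.mk t :=
    ConjClasses.mk_eq_mk_iff_isConj.2 (isConj_iff.2 ⟨w, by rw [ht']; group⟩)
  have hv' := hv t'
  rw [hclass] at hv'
  have hvt := hv t
  set t₀ := (ConjClasses.mk t).out
  change c w t = c (v t) t + c (v t') t'
  generalize v t = a at *
  generalize v t' = b at *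
  have ht₀e : t₀ = a⁻¹ * t * a := by rw [← hvt]; group
  have ht₀ : t₀ ∈ T := by simpa [ht₀e] using hT t ht a⁻¹
  have h1 := hmul w b t
  rw [← ht'] at h1
  have h2 := hmul a (a⁻¹ * (w * b)) t
  rw [mul_inv_cancel_left, h1, ← ht₀e, hcomm t₀ ht₀ _ ?_, add_zero] at h2
  · rw [← h2, add_assoc, CharTwo.add_self_eq_zero, add_zero]
  · have : a⁻¹ * (w * b) * t₀ * (a⁻¹ * (w * b))⁻¹ = a⁻¹ * (w * (b * t₀ * b⁻¹) * w⁻¹) * a := by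
      group
    rw [this, hv', ht', ht₀e]; group

theorem sum_cocycle_eq_zero {W H : Type*} [Group W] [Group H] [Fintype W] {T : Set W}
    (hT : ∀ t ∈ T, ∀ w, w * t * w⁻¹ ∈ T) {c : W → W → ZMod 2}
    (hmul : ∀ x y r, c (x * y) r = c x r + c y (x⁻¹ * r * x))
    (hcomm : ∀ t ∈ T, ∀ w, w * t * w⁻¹ = t → c w t = 0) (ρ : W →* H) (r : H) {g : W}
    (hg : ρ g = 1) {F : Finset W} (hF : ∀ t, t ∈ F ↔ t ∈ T ∧ ρ t = r) :
    ∑ t ∈ F, c g t = 0 := by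
  obtain ⟨f, hf⟩ := exists_coboundary hT hmul hcomm
  rw [Finset.sum_congr rfl fun t ht => hf t ((hF t).1 ht).1 g, Finset.sum_add_distrib]
  have : ∑ t ∈ F, f (g⁻¹ * t * g) = ∑ t ∈ F, f t := by
    refine Finset.sum_equiv (MulAut.conj g⁻¹).toEquiv (fun t => ?_) fun t _ => by simp
    have hρ : ρ (g⁻¹ * t * g) = ρ t := by simp [hg]
    have hconj : (MulAut.conj g⁻¹).toEquiv t = g⁻¹ * t * g := by simp
    rw [hconj, hF, hF, hρ]
    refine and_congr_left fun _ => ⟨fun h => by simpa using hT t h g⁻¹, fun h => ?_⟩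
    have := hT _ h g
    rwa [show g * (g⁻¹ * t * g) * g⁻¹ = t by group] at this
  rw [this, CharTwo.add_self_eq_zero]

namespace IsOrthogonalReflectionRep

variable {W V : Type*} [Group W] [AddCommGroup V] [Module ℝ V] {π : W →* (V →ₗ[ℝ] V)}
  {B : V →ₗ[ℝ] V →ₗ[ℝ] ℝ} {T : Set W}

theorem apply_normalVec_self (h : IsOrthogonalReflectionRep π B T) {z : V}
    (hz : IsRegularVector π T z) {t : W} (ht : t ∈ T) :
    π t (normalVec π B z t) = - normalVec π B z t := by
  rw [h.apply_eq_sub hz ht, mul_div_assoc, div_self (h.normalVec_self_pos hz ht).ne']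
  module

/-- An inversion cocycle for any set of reflections vanishes on the fixer of a normal vector. -/
theorem cocycle_eq_zero_of_fix [Finite W] (h : IsOrthogonalReflectionRep π B T) {z : V}
    (hz : IsRegularVector π T z) {S : Set W} {N : W → W → ZMod 2} (hN : IsInversionCocycle S N)
    (hTS : ∀ t ∈ T, ∃ v, ∃ s ∈ S, t = v * s * v⁻¹) {t : W} (ht : t ∈ T) {u : W}
    (hu : π u (normalVec π B z t) = normalVec π B z t) :
    u * t * u⁻¹ = t ∧ N u t = 0 := by
  have hmem := h.mem_closure_of_apply_eq hu
  have hbase : ∀ t' ∈ {t' | t' ∈ T ∧ π t' (normalVec π B z t) = normalVec π B z t},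
      t' * t * t'⁻¹ = t ∧ N t' t = 0 := by
    rintro t' ⟨ht', hfix⟩
    have hc : t' * t * t'⁻¹ = t := by
      obtain ⟨-, h1⟩ := h.apply_normalVec hz ht t'
      rw [hfix, h.normalVec_apply hz ht, one_smul] at h1
      exact h.normalVec_injOn hz (h.conj_mem t ht t') ht h1.symm
    refine ⟨hc, ?_⟩
    have hne : t ≠ t' := by
      rintro rfl
      rw [h.apply_normalVec_self hz ht] at hfix
      have h0 : normalVec π B z t = 0 := by
        have : (2 : ℝ) • normalVec π B z t = 0 := by
          nth_rewrite 1 [two_smul, ← hfix]; exact neg_add_cancel _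
        simpa using this
      have := h.normalVec_self_pos hz ht
      simp [h0] at this
    obtain ⟨v, s, hs, rfl⟩ := hTS t' ht'
    have e1 : (v * s)⁻¹ * t * (v * s) = v⁻¹ * ((v * s * v⁻¹)⁻¹ * t * (v * s * v⁻¹)) * v := by
      group
    have e2 : (v * s * v⁻¹)⁻¹ * t * (v * s * v⁻¹) = t := by
      conv_lhs => rw [← hc]
      group
    have e3 : v * (v⁻¹ * t * v) * v⁻¹ = t := by group
    rw [hN.mul, hN.mul, hN.inv, e1, e2, e3, hN.simple_ne s hs, add_zero,
      CharTwo.add_self_eq_zero]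
    rintro rfl
    exact hne (by group)
  induction hmem using Subgroup.closure_induction with
  | mem x hx => exact hbase x hx
  | one => exact ⟨by simp, hN.one t⟩
  | mul x y hx hy ihx ihy =>
    have fx : ∀ x ∈ Subgroup.closure
        {t' | t' ∈ T ∧ π t' (normalVec π B z t) = normalVec π B z t},
        π x (normalVec π B z t) = normalVec π B z t := by
      intro x hx
      induction hx using Subgroup.closure_induction with
      | mem x hx => exact hx.2
      | one => simp
      | mul a b _ _ ha hb => rw [map_mul_apply, hb, ha]
      | inv a _ ha =>
        conv_lhs => rw [← ha]
        exact map_inv_apply_self _ _ _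
    obtain ⟨a1, a2⟩ := ihx (fx x hx)
    obtain ⟨b1, b2⟩ := ihy (fx y hy)
    have e : x⁻¹ * t * x = t := by
      conv_lhs => rw [← a1]
      group
    refine ⟨?_, by rw [hN.mul, e, a2, b2, add_zero]⟩
    rw [show x * y * t * (x * y)⁻¹ = x * (y * t * y⁻¹) * x⁻¹ by group, b1, a1]
  | inv x hx ih =>
    obtain ⟨a1, a2⟩ := ih (by
      conv_lhs => rw [← hu]
      exact map_apply_inv_self _ _ _)
    refine ⟨?_, by rw [hN.inv, a1, a2]⟩
    conv_lhs => rw [← a1]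
    group

theorem cocycle_eq_separates [Finite W] (h : IsOrthogonalReflectionRep π B T) {z : V}
    (hz : IsRegularVector π T z) {S : Set W} {N : W → W → ZMod 2} (hN : IsInversionCocycle S N)
    (hTS : ∀ t ∈ T, ∃ v, ∃ s ∈ S, t = v * s * v⁻¹) {t : W} (ht : t ∈ T) {w : W}
    (hw : w * t * w⁻¹ = t) : N w t = separates π B T z w t := by
  obtain ⟨hc0, hc⟩ := h.apply_normalVec hz ht w
  rw [hw] at hc
  set c := B (π w (normalVec π B z t)) z with hcdef
  have hpos := h.normalVec_self_pos hz ht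
  have hsq : c * c = 1 := by
    have := h.invariant w (normalVec π B z t) (normalVec π B z t)
    rw [hc] at this
    simp only [map_smul, LinearMap.smul_apply, smul_eq_mul] at this
    have h2 : (c * c - 1) * B (normalVec π B z t) (normalVec π B z t) = 0 := by linarith
    rcases mul_eq_zero.1 h2 with h3 | h3
    · linarith
    · exact absurd h3 hpos.ne'
  have hval : c * B (normalVec π B z t) (π w z) = 1 := by
    have := h.invariant w (normalVec π B z t) z
    rw [hc] at this
    simpa [h.normalVec_apply hz ht] using this
  rcases mul_self_eq_one_iff.1 hsq with h1 | h1
  · rw [h1, one_smul] at hc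
    rw [(h.cocycle_eq_zero_of_fix hz hN hTS ht hc).2, separates, if_neg]
    rintro ⟨-, hneg⟩
    rw [h1, one_mul] at hval
    exact ((h.sideForm_pos_iff hz ht (π w z)).2 (by rw [hval]; exact one_pos)).not_gt hneg
  · rw [h1] at hc hval
    have hfix : π (t * w) (normalVec π B z t) = normalVec π B z t := by
      rw [map_mul_apply, hc, map_smul, h.apply_normalVec_self hz ht]; module
    have h0 := (h.cocycle_eq_zero_of_fix hz hN hTS ht hfix).2
    obtain ⟨v, s, hs, hts⟩ := hTS t ht
    have htt : N t t = 1 := by rw [hts]; exact hN.conj_self hs v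
    rw [hN.mul, htt, inv_mul_cancel, one_mul] at h0
    have hN1 : N w t = 1 := by
      rcases zmod_two_eq_zero_or_one (N w t) with h2 | h2
      · rw [h2] at h0; exact absurd h0 (by decide)
      · exact h2
    have hneg : sideForm π B t z (π w z) < 0 := by
      refine lt_of_le_of_ne (not_lt.1 fun hpos' => ?_)
        (h.sideForm_ne_zero ht (hz t ht) (h.isRegularVector_apply hz w t ht))
      have := (h.sideForm_pos_iff hz ht (π w z)).1 hpos'
      linarith
    rw [hN1, separates, if_pos ⟨ht, hneg⟩]

/-- Two inversion cocycles attached to the same reflections have the same partial sums over the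
fibres of a homomorphism, on its kernel. -/
theorem sum_cocycle_eq_sum_separates [Fintype W] (h : IsOrthogonalReflectionRep π B T) {z : V}
    (hz : IsRegularVector π T z) {S : Set W} {N : W → W → ZMod 2} (hN : IsInversionCocycle S N)
    (hTS : ∀ t ∈ T, ∃ v, ∃ s ∈ S, t = v * s * v⁻¹) {H : Type*} [Group H] (ρ : W →* H) (r : H)
    {g : W} (hg : ρ g = 1) {F : Finset W} (hF : ∀ t, t ∈ F ↔ t ∈ T ∧ ρ t = r) :
    ∑ t ∈ F, N g t = ∑ t ∈ F, separates π B T z g t := by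
  have := sum_cocycle_eq_zero h.conj_mem (c := fun w t => N w t + separates π B T z w t)
    (fun x y r => by
      simp only [hN.mul, h.separates_cocycle hz]; ring)
    (fun t ht w hw => by
      simp only [h.cocycle_eq_separates hz hN hTS ht hw, CharTwo.add_self_eq_zero]) ρ r hg hF
  rw [Finset.sum_add_distrib] at this
  exact CharTwo.add_eq_zero.1 this

end IsOrthogonalReflectionRep

/-- The derivative of the polynomial `f` at `x` in the direction `u`. -/
def dirDeriv {n : ℕ} (x u : Fin n → ℝ) (f : MvPolynomial (Fin n) ℝ) : ℝ :=
  ∑ i, u i * eval x (pderiv i f)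

section dirDeriv

variable {n m : ℕ} (x u u' : Fin n → ℝ)

@[simp]
theorem dirDeriv_add (f g : MvPolynomial (Fin n) ℝ) :
    dirDeriv x u (f + g) = dirDeriv x u f + dirDeriv x u g := by
  simp only [dirDeriv, map_add, mul_add, Finset.sum_add_distrib]

@[simp]
theorem dirDeriv_mul (f g : MvPolynomial (Fin n) ℝ) :
    dirDeriv x u (f * g) = eval x f * dirDeriv x u g + eval x g * dirDeriv x u f := by
  simp only [dirDeriv, Finset.mul_sum, ← Finset.sum_add_distrib, Derivation.leibniz, map_add,
    smul_eq_mul, map_mul]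
  exact Finset.sum_congr rfl fun i _ => by ring

@[simp]
theorem dirDeriv_C (a : ℝ) : dirDeriv x u (C a) = 0 := by
  simp [dirDeriv]

@[simp]
theorem dirDeriv_zero : dirDeriv x u 0 = 0 := by
  simp [dirDeriv]

@[simp]
theorem dirDeriv_X (i : Fin n) : dirDeriv x u (X i) = u i := by
  simp [dirDeriv, pderiv_X, Pi.single_apply]

@[simp]
theorem dirDeriv_sub (f g : MvPolynomial (Fin n) ℝ) :
    dirDeriv x u (f - g) = dirDeriv x u f - dirDeriv x u g := by
  simp only [dirDeriv, map_sub, mul_sub, Finset.sum_sub_distrib]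

@[simp]
theorem dirDeriv_smul (a : ℝ) (f : MvPolynomial (Fin n) ℝ) :
    dirDeriv x u (a • f) = a * dirDeriv x u f := by
  rw [smul_eq_C_mul, dirDeriv_mul]; simp

@[simp]
theorem dirDeriv_sum {ι : Type*} (s : Finset ι) (f : ι → MvPolynomial (Fin n) ℝ) :
    dirDeriv x u (∑ i ∈ s, f i) = ∑ i ∈ s, dirDeriv x u (f i) := by
  classical
  induction s using Finset.induction_on with
  | empty => simp
  | insert a s ha ih => rw [Finset.sum_insert ha, Finset.sum_insert ha, dirDeriv_add, ih]

theorem dirDeriv_dir_sub (f : MvPolynomial (Fin n) ℝ) :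
    dirDeriv x (u - u') f = dirDeriv x u f - dirDeriv x u' f := by
  simp only [dirDeriv, Pi.sub_apply, sub_mul, Finset.sum_sub_distrib]

theorem dirDeriv_dir_add (f : MvPolynomial (Fin n) ℝ) :
    dirDeriv x (u + u') f = dirDeriv x u f + dirDeriv x u' f := by
  simp only [dirDeriv, Pi.add_apply, add_mul, Finset.sum_add_distrib]

theorem dirDeriv_dir_smul (a : ℝ) (f : MvPolynomial (Fin n) ℝ) :
    dirDeriv x (a • u) f = a * dirDeriv x u f := by
  simp only [dirDeriv, Pi.smul_apply, smul_eq_mul, Finset.mul_sum, mul_assoc]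

theorem eval_aeval (q : Fin m → MvPolynomial (Fin n) ℝ) (F : MvPolynomial (Fin m) ℝ) :
    eval x (aeval q F) = eval (fun j => eval x (q j)) F := by
  induction F using MvPolynomial.induction_on with
  | C a => simp
  | add f g hf hg => simp only [map_add, hf, hg]
  | mul_X f i hf => simp only [map_mul, hf, aeval_X, eval_X]

/-- The chain rule. -/
theorem dirDeriv_aeval (q : Fin m → MvPolynomial (Fin n) ℝ) (F : MvPolynomial (Fin m) ℝ) :
    dirDeriv x u (aeval q F) =
      dirDeriv (fun j => eval x (q j)) (fun j => dirDeriv x u (q j)) F := by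
  induction F using MvPolynomial.induction_on with
  | C a => simp [MvPolynomial.algebraMap_eq]
  | add f g hf hg => simp only [map_add, dirDeriv_add, hf, hg]
  | mul_X f i hf =>
    simp only [map_mul, dirDeriv_mul, hf, aeval_X, eval_aeval, eval_X, dirDeriv_X]

/-- A polynomial vanishing to second order at `x` lies in the square of the ideal of `x`. -/
theorem mem_ker_eval_sq {f : MvPolynomial (Fin n) ℝ} (h0 : eval x f = 0)
    (h1 : ∀ u, dirDeriv x u f = 0) : f ∈ RingHom.ker (eval x) * RingHom.ker (eval x) := by
  set 𝔪 := RingHom.ker (eval x) with h𝔪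
  let ℓ : MvPolynomial (Fin n) ℝ → MvPolynomial (Fin n) ℝ := fun f =>
    ∑ i, C (dirDeriv x (Pi.single i 1) f) * (X i - C (x i))
  have hℓ : ∀ f, ℓ f ∈ 𝔪 := fun f => by
    rw [h𝔪, RingHom.mem_ker]; simp [ℓ]
  suffices H : ∀ f, f - C (eval x f) - ℓ f ∈ 𝔪 * 𝔪 by
    have := H f
    simpa [h0, ℓ, h1] using this
  intro f
  induction f using MvPolynomial.induction_on with
  | C a => simp [ℓ]
  | add f g hf hg =>
    have e : ℓ (f + g) = ℓ f + ℓ g := by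
      simp only [ℓ, dirDeriv_add, C_add, add_mul, Finset.sum_add_distrib]
    have := add_mem hf hg
    rw [e, map_add, C_add]
    convert this using 1
    ring
  | mul_X f j hf =>
    have e : ℓ (f * X j) = C (eval x f) * (X j - C (x j)) + C (x j) * ℓ f := by
      simp only [ℓ, dirDeriv_mul, C_add, C_mul, add_mul, Finset.sum_add_distrib, dirDeriv_X,
        eval_X, Finset.mul_sum, mul_assoc]
      congr 1
      rw [Finset.sum_eq_single j]
      · simp
      · intro b _ hb
        simp [hb.symm]
      · simp
    have hXj : X j - C (x j) ∈ 𝔪 := by rw [h𝔪, RingHom.mem_ker]; simp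
    have h2 := add_mem (Ideal.mul_mem_right (X j) _ hf) (Ideal.mul_mem_mul (hℓ f) hXj)
    rw [e]
    convert h2 using 1
    simp only [map_mul, eval_X]
    ring

end dirDeriv

section action

variable {n m : ℕ}

theorem eval_matAct (g : Matrix.GeneralLinearGroup (Fin n) ℝ) (f : MvPolynomial (Fin n) ℝ)
    (x : Fin n → ℝ) :
    eval x (matAct g f) = eval ((↑(g⁻¹) : Matrix (Fin n) (Fin n) ℝ).mulVec x) f := by
  rw [matAct, eval_aeval]
  congr 2
  funext j
  simp [Matrix.mulVec, dotProduct]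

theorem dirDeriv_matAct (g : Matrix.GeneralLinearGroup (Fin n) ℝ) (f : MvPolynomial (Fin n) ℝ)
    (x u : Fin n → ℝ) :
    dirDeriv x u (matAct g f) = dirDeriv ((↑(g⁻¹) : Matrix (Fin n) (Fin n) ℝ).mulVec x)
      ((↑(g⁻¹) : Matrix (Fin n) (Fin n) ℝ).mulVec u) f := by
  rw [matAct, dirDeriv_aeval]
  congr 1 <;> funext j <;> simp [Matrix.mulVec, dotProduct]

theorem eval_polyAct (M : Fin m → Fin m → ℝ) (f : MvPolynomial (Fin m) ℝ) (y : Fin m → ℝ) :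
    eval y (polyAct M f) = eval ((Matrix.of M).mulVec y) f := by
  rw [polyAct, eval_aeval]
  congr 2
  funext j
  simp [Matrix.mulVec, dotProduct]

theorem dirDeriv_polyAct (M : Fin m → Fin m → ℝ) (f : MvPolynomial (Fin m) ℝ)
    (y v : Fin m → ℝ) : dirDeriv y v (polyAct M f) =
      dirDeriv ((Matrix.of M).mulVec y) ((Matrix.of M).mulVec v) f := by
  rw [polyAct, dirDeriv_aeval]
  congr 1 <;> funext j <;> simp [Matrix.mulVec, dotProduct]

theorem polyAct_polyAct_self {M : Fin m → Fin m → ℝ}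
    (hM : Matrix.of M * Matrix.of M = 1) (f : MvPolynomial (Fin m) ℝ) :
    polyAct M (polyAct M f) = f := by
  refine MvPolynomial.funext fun y => ?_
  rw [eval_polyAct, eval_polyAct, Matrix.mulVec_mulVec, hM, Matrix.one_mulVec]

theorem matAct_mul (g h : Matrix.GeneralLinearGroup (Fin n) ℝ) (f : MvPolynomial (Fin n) ℝ) :
    matAct (g * h) f = matAct g (matAct h f) := by
  refine MvPolynomial.funext fun y => ?_
  rw [eval_matAct, eval_matAct, eval_matAct, mul_inv_rev, Units.val_mul, Matrix.mulVec_mulVec]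

theorem matAct_one (f : MvPolynomial (Fin n) ℝ) : matAct 1 f = f := by
  refine MvPolynomial.funext fun y => ?_
  rw [eval_matAct, inv_one, Units.val_one, Matrix.one_mulVec]

/-- The sum of the translates of a polynomial under a finite group. -/
def trace (G : Subgroup (Matrix.GeneralLinearGroup (Fin n) ℝ)) [Fintype G] :
    MvPolynomial (Fin n) ℝ →ₗ[ℝ] MvPolynomial (Fin n) ℝ :=
  ∑ g : G, (matAct (g : Matrix.GeneralLinearGroup (Fin n) ℝ)).toLinearMap

variable {G : Subgroup (Matrix.GeneralLinearGroup (Fin n) ℝ)} [Fintype G]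

theorem trace_apply (f : MvPolynomial (Fin n) ℝ) :
    trace G f = ∑ g : G, matAct (g : Matrix.GeneralLinearGroup (Fin n) ℝ) f := by
  simp [trace]

theorem trace_mem (f : MvPolynomial (Fin n) ℝ) : trace G f ∈ invariants G := by
  intro g hg
  rw [trace_apply, map_sum]
  simp only [← matAct_mul]
  exact Fintype.sum_equiv (Equiv.mulLeft (⟨g, hg⟩ : G)) _ _ fun h => rfl

theorem trace_mul {a : MvPolynomial (Fin n) ℝ} (ha : a ∈ invariants G)
    (f : MvPolynomial (Fin n) ℝ) : trace G (a * f) = a * trace G f := by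
  rw [trace_apply, trace_apply, Finset.mul_sum]
  exact Finset.sum_congr rfl fun g _ => by rw [map_mul, ha g g.2]

end action

/-- If an involution acts trivially on `I / A₊I`, then, away from a hypersurface not passing
through the origin, `I` is generated by its fixed elements. -/
theorem exists_mul_mem_span_fixed {A : Type*} [CommRing A] [Algebra ℝ A] [IsNoetherianRing A]
    {τ : A →ₐ[ℝ] A} (hτ : ∀ f, τ (τ f) = f) {I P : Ideal A}
    (h : ∀ f ∈ I, τ f - f ∈ P * I) :
    ∃ c₀, c₀ - 1 ∈ P ∧ ∀ f ∈ I, c₀ * f ∈ Ideal.span {f | f ∈ I ∧ τ f = f} := by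
  have hI : ∀ f ∈ I, τ f ∈ I := fun f hf => by
    have := add_mem (Ideal.mul_le_right (I := P) (h f hf)) hf
    rwa [sub_add_cancel] at this
  have hle : I ≤ Ideal.span {f | f ∈ I ∧ τ f = f} ⊔ P • I := by
    intro f hf
    have h1 : (2⁻¹ : ℝ) • (f + τ f) ∈ Ideal.span {f | f ∈ I ∧ τ f = f} := by
      refine Ideal.subset_span ⟨?_, ?_⟩
      · rw [Algebra.smul_def]
        exact Ideal.mul_mem_left _ _ (add_mem hf (hI f hf))
      · rw [map_smul, map_add, hτ, add_comm]
    have h2 : (2⁻¹ : ℝ) • (f - τ f) ∈ P • I := by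
      rw [Algebra.smul_def (2⁻¹ : ℝ) (f - τ f), ← neg_sub]
      exact Ideal.mul_mem_left _ _ (neg_mem (h f hf))
    have := Submodule.add_mem_sup h1 h2
    rwa [← smul_add, show f + τ f + (f - τ f) = (2 : ℝ) • f by rw [two_smul]; ring, smul_smul,
      inv_mul_cancel₀ two_ne_zero, one_smul] at this
  obtain ⟨r, hr, hrI⟩ := Submodule.exists_sub_one_mem_and_smul_le_of_fg_of_le_sup
    (IsNoetherian.noetherian I) le_rfl hle
  exact ⟨r, hr, fun f hf => hrI (Submodule.smul_mem_pointwise_smul f r I hf)⟩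

section etale

variable {n m : ℕ}

/-- The squared distance to `y`. -/
def sqDist (y : Fin n → ℝ) : MvPolynomial (Fin n) ℝ := ∑ i, (X i - C (y i)) ^ 2

theorem eval_sqDist_eq_zero {x y : Fin n → ℝ} : eval x (sqDist y) = 0 ↔ x = y := by
  simp only [sqDist, map_sum, map_pow, map_sub, eval_X, eval_C]
  rw [Finset.sum_eq_zero_iff_of_nonneg fun i _ => sq_nonneg _]
  simp [sub_eq_zero, funext_iff]

variable {G : Subgroup (Matrix.GeneralLinearGroup (Fin n) ℝ)} [Fintype G] {x : Fin n → ℝ}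

theorem matOf_one {k : Type} [Field k] {W : Subgroup (Matrix.GeneralLinearGroup (Fin n) k)} :
    matOf (1 : W) = 1 := rfl

theorem eval_trace (f : MvPolynomial (Fin n) ℝ) :
    eval x (trace G f) =
      ∑ g : G, eval ((matOf g⁻¹).mulVec x) f := by
  rw [trace_apply, map_sum]
  exact Finset.sum_congr rfl fun g _ => eval_matAct _ _ _

/-- A polynomial taking the value `1` at a point with trivial stabilizer and vanishing on the
rest of its orbit. -/
theorem exists_eval_eq_one
    (hx : ∀ g ∈ G, (g : Matrix (Fin n) (Fin n) ℝ).mulVec x = x → g = 1) :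
    ∃ f : MvPolynomial (Fin n) ℝ, eval x f = 1 ∧
      ∀ g ∈ G, g ≠ 1 → eval ((g : Matrix (Fin n) (Fin n) ℝ).mulVec x) f = 0 := by
  classical
  set q : MvPolynomial (Fin n) ℝ :=
    ∏ g ∈ Finset.univ.filter (fun g : G => g ≠ 1),
      sqDist ((matOf g).mulVec x) with hq
  have h0 : eval x q ≠ 0 := by
    rw [hq, map_prod, Finset.prod_ne_zero_iff]
    intro g hg h
    exact (Finset.mem_filter.1 hg).2 (Subtype.ext (hx g g.2 (eval_sqDist_eq_zero.1 h).symm))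
  refine ⟨C (eval x q)⁻¹ * q, by simp [h0], fun g hg hg1 => ?_⟩
  have hq0 : eval ((g : Matrix (Fin n) (Fin n) ℝ).mulVec x) q = 0 := by
    rw [hq, map_prod]
    exact Finset.prod_eq_zero (i := ⟨g, hg⟩) (Finset.mem_filter.2
      ⟨Finset.mem_univ _, fun h => hg1 (congrArg Subtype.val h)⟩) (eval_sqDist_eq_zero.2 rfl)
  rw [map_mul, hq0, mul_zero]

theorem exists_mul_mem_span_invariants
    (hx : ∀ g ∈ G, (g : Matrix (Fin n) (Fin n) ℝ).mulVec x = x → g = 1) :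
    ∃ s : MvPolynomial (Fin n) ℝ, eval x s = 1 ∧
      (∀ g ∈ G, g ≠ 1 → eval ((g : Matrix (Fin n) (Fin n) ℝ).mulVec x) s = 0) ∧
      ∀ q, eval x q = 0 → s * q ∈ Ideal.span {a | a ∈ invariants G ∧ eval x a = 0} := by
  classical
  obtain ⟨f, hf1, hf0⟩ := exists_eval_eq_one hx
  have hinv : ∀ g : G, g ≠ 1 → eval ((matOf g⁻¹).mulVec x) f = 0 :=
    fun g hg => hf0 _ (g⁻¹).2 (by simpa using hg)
  let P : Polynomial (MvPolynomial (Fin n) ℝ) :=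
    ∏ g ∈ Finset.univ.filter (fun g : G => g ≠ 1),
      (Polynomial.X - Polynomial.C (matAct (g : Matrix.GeneralLinearGroup (Fin n) ℝ) f))
  have hP : ∀ g : G, g ≠ 1 → Polynomial.eval (matAct (g : Matrix.GeneralLinearGroup (Fin n) ℝ) f) P
      = 0 := fun g hg => by
    rw [Polynomial.eval_prod]
    exact Finset.prod_eq_zero (i := g) (by simpa using hg) (by simp)
  have he : eval x (Polynomial.eval f P) = 1 := by
    rw [Polynomial.eval_prod, map_prod]
    refine Finset.prod_eq_one fun g hg => ?_
    have := hinv g (Finset.mem_filter.1 hg).2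
    rw [Polynomial.eval_sub, Polynomial.eval_X, Polynomial.eval_C, map_sub, hf1, eval_matAct]
    exact sub_eq_self.2 this
  have hsum : ∀ q, Polynomial.eval f P * q =
      ∑ i ∈ Finset.range (P.natDegree + 1), P.coeff i * trace G (f ^ i * q) := by
    intro q
    simp only [trace_apply, Finset.mul_sum]
    rw [Finset.sum_comm, Finset.sum_eq_single (1 : G)]
    · rw [Polynomial.eval_eq_sum_range, Finset.sum_mul]
      exact Finset.sum_congr rfl fun i _ => by rw [Subgroup.coe_one, matAct_one, mul_assoc]
    · intro g _ hg
      have := hP g hg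
      rw [Polynomial.eval_eq_sum_range] at this
      simp only [map_mul, map_pow, ← mul_assoc, ← Finset.sum_mul, this, zero_mul]
    · simp
  refine ⟨Polynomial.eval f P * f, by rw [map_mul, he, hf1, one_mul], fun g hg hg1 => by
    rw [map_mul, hf0 g hg hg1, mul_zero], fun q hq => ?_⟩
  rw [mul_assoc, hsum]
  refine Ideal.sum_mem _ fun i _ => Ideal.mul_mem_left _ _ (Ideal.subset_span ⟨trace_mem _, ?_⟩)
  rw [eval_trace]
  refine Finset.sum_eq_zero fun g _ => ?_
  by_cases hg : g = 1
  · simp [hg, hq, matOf_one]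
  · simp [hinv g hg]

/-- A derivation of the invariants at the image of a point with trivial stabilizer vanishes on
the invariants that vanish to second order at this point. -/
theorem derivation_eq_zero
    (hx : ∀ g ∈ G, (g : Matrix (Fin n) (Fin n) ℝ).mulVec x = x → g = 1)
    {D : MvPolynomial (Fin n) ℝ → ℝ}
    (hadd : ∀ a ∈ invariants G, ∀ b ∈ invariants G, D (a + b) = D a + D b)
    (hmul : ∀ a ∈ invariants G, ∀ b ∈ invariants G,
      D (a * b) = eval x a * D b + eval x b * D a)
    {a : MvPolynomial (Fin n) ℝ} (ha : a ∈ invariants G) (h0 : eval x a = 0)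
    (h1 : ∀ u, dirDeriv x u a = 0) : D a = 0 := by
  obtain ⟨s, hs1, hs0, hs⟩ := exists_mul_mem_span_invariants hx
  set P := Ideal.span {a | a ∈ invariants G ∧ eval x a = 0} with hP
  have hmem : s * s * a ∈ P * P := by
    have : a ∈ RingHom.ker (eval x) * RingHom.ker (eval x) := mem_ker_eval_sq x h0 h1
    clear ha h0 h1
    induction this using Submodule.mul_induction_on' with
    | mem_mul_mem b hb c hc =>
      rw [show s * s * (b * c) = (s * b) * (s * c) by ring]
      exact Ideal.mul_mem_mul (hs b hb) (hs c hc)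
    | add b _ c _ hb hc => rw [mul_add]; exact add_mem hb hc
  have hQ : ∀ f ∈ P * P, ∀ b, D (trace G (b * f)) = 0 := by
    intro f hf
    rw [hP, Ideal.span_mul_span'] at hf
    induction hf using Submodule.span_induction with
    | mem f hf =>
      obtain ⟨a, ⟨ha, ha0⟩, b, ⟨hb, hb0⟩, rfl⟩ := hf
      intro c
      rw [show c * ((fun x y => x * y) a b) = a * (b * c) by ring, trace_mul ha, trace_mul hb,
        hmul _ ha _ (mul_mem hb (trace_mem _)), map_mul, ha0, hb0]
      ring
    | zero =>
      intro b
      have := hadd 0 (zero_mem _) 0 (zero_mem _)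
      rw [add_zero] at this
      rw [mul_zero, map_zero]; linarith
    | add f g _ _ hf hg =>
      intro b
      rw [mul_add, map_add, hadd _ (trace_mem _) _ (trace_mem _), hf, hg, add_zero]
    | smul c f _ hf =>
      intro b
      rw [smul_eq_mul, ← mul_assoc]; exact hf _
  have key := hQ _ hmem 1
  rw [one_mul, mul_comm, trace_mul ha, hmul _ ha _ (trace_mem _), h0, zero_mul, zero_add,
    eval_trace, Finset.sum_eq_single (1 : G)] at key
  · simpa [hs1, matOf_one] using key
  · intro g _ hg
    rw [map_mul]
    exact mul_eq_zero_of_left (hs0 _ (g⁻¹).2 (by simpa using hg)) _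
  · simp

/-- At a point with trivial stabilizer the quotient map is submersive onto the tangent space of
the quotient. -/
theorem exists_dirDeriv_eq
    (hx : ∀ g ∈ G, (g : Matrix (Fin n) (Fin n) ℝ).mulVec x = x → g = 1)
    {p : Fin m → MvPolynomial (Fin n) ℝ}
    (hp : Algebra.adjoin ℝ (Set.range p) = invariants G) {v : Fin m → ℝ}
    (hv : ∀ f ∈ relIdeal p, dirDeriv (pMap p x) v f = 0) :
    ∃ u, ∀ j, dirDeriv x u (p j) = v j := by
  have hmem : ∀ a, a ∈ invariants G ↔ ∃ F, aeval p F = a := fun a => by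
    rw [← hp, Algebra.adjoin_range_eq_range_aeval]; rfl
  have hfac : Function.FactorsThrough (dirDeriv (pMap p x) v) (aeval p) := by
    intro F F' h
    have := hv (F - F') (by rw [relIdeal, RingHom.mem_ker, map_sub]; exact sub_eq_zero.2 h)
    rwa [dirDeriv_sub, sub_eq_zero] at this
  let D := Function.extend (aeval p) (dirDeriv (pMap p x) v) 0
  have hD : ∀ F, D (aeval p F) = dirDeriv (pMap p x) v F := fun F => hfac.extend_apply _ F
  have hadd : ∀ a ∈ invariants G, ∀ b ∈ invariants G, D (a + b) = D a + D b := by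
    intro a ha b hb
    obtain ⟨F, rfl⟩ := (hmem a).1 ha
    obtain ⟨F', rfl⟩ := (hmem b).1 hb
    rw [← map_add, hD, hD, hD, dirDeriv_add]
  have hmul : ∀ a ∈ invariants G, ∀ b ∈ invariants G,
      D (a * b) = eval x a * D b + eval x b * D a := by
    intro a ha b hb
    obtain ⟨F, rfl⟩ := (hmem a).1 ha
    obtain ⟨F', rfl⟩ := (hmem b).1 hb
    rw [← map_mul, hD, hD, hD, dirDeriv_mul, eval_aeval, eval_aeval]; rfl
  let L : (Fin n → ℝ) →ₗ[ℝ] (Fin m → ℝ) :=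
    { toFun := fun u j => dirDeriv x u (p j)
      map_add' := fun u u' => funext fun j => dirDeriv_dir_add x u u' _
      map_smul' := fun a u => funext fun j => dirDeriv_dir_smul x u a _ }
  suffices v ∈ LinearMap.range L by
    obtain ⟨u, hu⟩ := this
    exact ⟨u, fun j => congrFun hu j⟩
  by_contra hnot
  obtain ⟨f, hfv, hf⟩ := Submodule.exists_le_ker_of_notMem hnot
  have hfe : ∀ w : Fin m → ℝ, f w = ∑ j, f (Pi.single j 1) * w j := fun w => by
    conv_lhs => rw [← Finset.univ_sum_single w, map_sum]
    refine Finset.sum_congr rfl fun j _ => ?_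
    rw [mul_comm, ← smul_eq_mul, ← map_smul, ← Pi.single_smul, smul_eq_mul, mul_one]
  set F : MvPolynomial (Fin m) ℝ := ∑ j, f (Pi.single j 1) • (X j - C (pMap p x j)) with hF
  have hDF : D (aeval p F) = f v := by
    rw [hD, hF, hfe v]; simp
  refine hfv ?_
  rw [← hDF]
  refine derivation_eq_zero hx hadd hmul ((hmem _).2 ⟨F, rfl⟩) ?_ fun u => ?_
  · rw [eval_aeval, hF]; simp [pMap, smul_eval]
  · have h1 : f (L u) = 0 := hf ⟨u, rfl⟩
    rw [hfe] at h1
    rw [dirDeriv_aeval, hF]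
    simpa [L] using h1

end etale

section quotient

variable {n m : ℕ} {Wt G : Subgroup (Matrix.GeneralLinearGroup (Fin n) ℝ)}
  {p : Fin m → MvPolynomial (Fin n) ℝ} {d : Fin m → ℕ} {c : ↥Wt → Fin m → Fin m → ℝ}

theorem QuotSetup.mem_invariants (hs : QuotSetup Wt G p d c) (i : Fin m) : p i ∈ invariants G := by
  rw [← hs.gen]
  exact Algebra.subset_adjoin ⟨i, rfl⟩

theorem QuotSetup.pMap_mulVec (hs : QuotSetup Wt G p d c) (w : ↥Wt) (x : Fin n → ℝ) :
    pMap p ((matOf w).mulVec x) = (qMat c w).mulVec (pMap p x) := by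
  funext i
  have h1 := congrArg (eval x) (hs.equivar w⁻¹ i)
  rw [eval_matAct, Subgroup.coe_inv, inv_inv] at h1
  refine h1.trans ?_
  simp [smul_eval, qMat, Matrix.mulVec, dotProduct, pMap]

theorem QuotSetup.pMap_zero (hs : QuotSetup Wt G p d c) : pMap p 0 = 0 := by
  funext i
  have h := (hs.homog i).coeff_eq_zero (d := 0) (by simpa using (hs.dpos i).ne)
  rw [pMap, MvPolynomial.eval_zero, constantCoeff_eq, h, Pi.zero_apply]

theorem QuotSetup.qMat_eq_one (hs : QuotSetup Wt G p d c) {g : ↥Wt}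
    (hg : (g : Matrix.GeneralLinearGroup (Fin n) ℝ) ∈ G) : qMat c g = 1 := by
  ext i j
  have h1 := hs.equivar g⁻¹ i
  rw [Subgroup.coe_inv, hs.mem_invariants i _ (inv_mem hg)] at h1
  have h2 : ∑ j, (c g⁻¹ i j - if i = j then 1 else 0) • p j = 0 := by
    simp [sub_smul, Finset.sum_sub_distrib, ← h1]
  have h3 := congrFun (hs.minimal _ (h2 ▸ zero_mem _)) j
  simpa [qMat, Matrix.one_apply, sub_eq_zero] using h3

theorem eval_zero_of_mem_idealPlus {f : MvPolynomial (Fin m) ℝ} (hf : f ∈ idealPlus ℝ m) :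
    eval 0 f = 0 := by
  have : idealPlus ℝ m ≤ RingHom.ker (eval (0 : Fin m → ℝ)) := by
    rw [idealPlus, Ideal.span_le]
    rintro _ ⟨i, rfl⟩
    simp [RingHom.mem_ker]
  exact this hf

theorem continuous_pMap : Continuous (pMap p) :=
  continuous_pi fun i => MvPolynomial.continuous_eval (p i)

/-- The tangent vectors to the quotient negated by the image of a reflection `σ` are proportional,
if the mirror of `σ` is not contained in a mirror of `G`. -/
theorem QuotSetup.exists_eq_smul_of_mulVec_eq_neg (hs : QuotSetup Wt G p d c)
    (htriv : TrivialConormal Wt p c) {σ : ↥Wt} (hσ : σ * σ = 1)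
    (hR : qMat c σ * qMat c σ = 1) {a : Fin n → ℝ}
    (ha : ∀ u, ∃ k : ℝ, u - (matOf σ).mulVec u = k • a) {x₀ : Fin n → ℝ}
    (hσx₀ : (matOf σ).mulVec x₀ = x₀)
    (hx₀ : ∀ g ∈ G, (g : Matrix (Fin n) (Fin n) ℝ).mulVec x₀ = x₀ → g = 1) :
    ∃ v₀, ∀ v, (qMat c σ).mulVec v = -v → ∃ k : ℝ, v = k • v₀ := by
  classical
  have : Finite G := (hs.finite.subset hs.le).to_subtype
  have := Fintype.ofFinite G
  have hσ' : σ⁻¹ = σ := inv_eq_of_mul_eq_one_left hσ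
  have hc : Matrix.of (c σ) = qMat c σ := by rw [qMat, hσ']
  obtain ⟨c₀, hc₀, hc₀I⟩ := exists_mul_mem_span_fixed (P := idealPlus ℝ m)
    (polyAct_polyAct_self (M := c σ) (by rw [hc, hR])) (htriv σ)
  have hc₀0 : eval 0 c₀ = 1 := by
    simpa [sub_eq_zero] using eval_zero_of_mem_idealPlus hc₀
  obtain ⟨ε, hεc, hε⟩ : ∃ ε : ℝ, eval (pMap p (ε • x₀)) c₀ ≠ 0 ∧ ε ≠ 0 := by
    have hcont : Continuous fun ε : ℝ => eval (pMap p (ε • x₀)) c₀ :=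
      (MvPolynomial.continuous_eval c₀).comp (continuous_pMap.comp (by fun_prop))
    have h1 : ∀ᶠ ε in nhds (0 : ℝ), eval (pMap p (ε • x₀)) c₀ ≠ 0 :=
      hcont.continuousAt.eventually_ne (by
        rw [zero_smul, hs.pMap_zero, hc₀0]; exact one_ne_zero)
    exact ((h1.filter_mono nhdsWithin_le_nhds).and
      (self_mem_nhdsWithin : {(0 : ℝ)}ᶜ ∈ nhdsWithin 0 _)).exists
  set x := ε • x₀ with hx
  have hσx : (matOf σ).mulVec x = x := by rw [hx, Matrix.mulVec_smul, hσx₀]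
  have hGx : ∀ g ∈ G, (g : Matrix (Fin n) (Fin n) ℝ).mulVec x = x → g = 1 := by
    intro g hg h
    refine hx₀ g hg ?_
    rw [hx, Matrix.mulVec_smul] at h
    exact smul_right_injective _ hε h
  refine ⟨fun j => dirDeriv x a (p j), fun v hv => ?_⟩
  have hRy : (qMat c σ).mulVec (pMap p x) = pMap p x := by rw [← hs.pMap_mulVec, hσx]
  have hI0 : ∀ f ∈ relIdeal p, eval (pMap p x) f = 0 := by
    intro f hf
    have : aeval p f = 0 := hf
    have h2 := eval_aeval x p f
    rw [this, map_zero] at h2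
    exact h2.symm
  have hD : ∀ f ∈ relIdeal p, dirDeriv (pMap p x) v f = 0 := by
    intro f hf
    have hJ : ∀ f ∈ Ideal.span {f | f ∈ relIdeal p ∧ polyAct (c σ) f = f},
        eval (pMap p x) f = 0 ∧ dirDeriv (pMap p x) v f = 0 := by
      intro f hf
      induction hf using Submodule.span_induction with
      | mem f hf =>
        refine ⟨hI0 f hf.1, ?_⟩
        have h1 := dirDeriv_polyAct (c σ) f (pMap p x) v
        rw [hf.2, hc, hRy, hv, ← neg_one_smul ℝ v, dirDeriv_dir_smul] at h1
        linarith
      | zero => simp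
      | add f g _ _ hf hg => simp [hf, hg]
      | smul r f _ hf => simp [hf]
    have := (hJ _ (hc₀I f hf)).2
    rw [dirDeriv_mul, hI0 f hf, zero_mul, add_zero] at this
    exact (mul_eq_zero.1 this).resolve_left hεc
  obtain ⟨u, hu⟩ := exists_dirDeriv_eq hGx hs.gen hD
  obtain ⟨r, hr⟩ := ha u
  refine ⟨r / 2, funext fun j => ?_⟩
  have h1 := dirDeriv_matAct (σ⁻¹ : ↥Wt) (p j) x u
  rw [hs.equivar, Subgroup.coe_inv, inv_inv] at h1
  have h2 : dirDeriv x ((matOf σ).mulVec u) (p j) = - v j := by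
    rw [← Pi.neg_apply v, ← hv]
    change _ = dirDeriv ((matOf σ).mulVec x) ((matOf σ).mulVec u) (p j) at h1
    rw [hσx] at h1
    rw [← h1]
    simp [hu, qMat, Matrix.mulVec, dotProduct]
  have h3 : dirDeriv x (u - (matOf σ).mulVec u) (p j) = 2 * v j := by
    rw [dirDeriv_dir_sub, hu, h2]; ring
  rw [hr, dirDeriv_dir_smul] at h3
  simp only [Pi.smul_apply, smul_eq_mul]
  linarith

theorem exists_linearMap_neg {V : Type*} [AddCommGroup V] [Module ℝ V] {R : V →ₗ[ℝ] V}
    (hR : ∀ y, R (R y) = y) {v₀ : V} (h : ∀ v, R v = -v → ∃ k : ℝ, v = k • v₀) :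
    ∃ f : V →ₗ[ℝ] ℝ, (∀ y, f (R y) = -f y) ∧ ∀ y, f y = 0 → R y = y := by
  have hsub : ∀ y, ∃ k : ℝ, y - R y = k • v₀ := fun y => h _ (by rw [map_sub, hR, neg_sub])
  obtain ⟨g, hg⟩ : ∃ g : V →ₗ[ℝ] ℝ, v₀ ≠ 0 → g v₀ ≠ 0 := by
    by_cases h0 : v₀ = 0
    · exact ⟨0, fun h => absurd h0 h⟩
    · obtain ⟨g, hg, -⟩ := Submodule.exists_le_ker_of_notMem (p := (⊥ : Submodule ℝ V))
        (by simpa using h0)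
      exact ⟨g, fun _ => hg⟩
  refine ⟨g ∘ₗ (LinearMap.id - R), fun y => ?_, fun y hy => ?_⟩
  · simp [hR]
  · obtain ⟨k, hk⟩ := hsub y
    have h1 : k * g v₀ = 0 := by
      rw [← smul_eq_mul, ← map_smul, ← hk]; exact hy
    have h2 : y - R y = 0 := by
      rw [hk]
      by_cases h0 : v₀ = 0
      · simp [h0]
      · rw [(mul_eq_zero.1 h1).resolve_right (hg h0), zero_smul]
    exact (sub_eq_zero.1 h2).symm

/-- The fibres of the quotient map are orbits. -/
theorem QuotSetup.exists_mulVec_eq_of_pMap_eq (hs : QuotSetup Wt G p d c) {x y : Fin n → ℝ}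
    (h : pMap p x = pMap p y) : ∃ g ∈ G, (g : Matrix (Fin n) (Fin n) ℝ).mulVec x = y := by
  classical
  have : Finite G := (hs.finite.subset hs.le).to_subtype
  have := Fintype.ofFinite G
  let F : MvPolynomial (Fin n) ℝ :=
    ∏ g : G, matAct (g : Matrix.GeneralLinearGroup (Fin n) ℝ) (sqDist x)
  have hF : F ∈ invariants G := by
    intro g hg
    simp only [F, map_prod, ← matAct_mul]
    exact Fintype.prod_equiv (Equiv.mulLeft (⟨g, hg⟩ : G)) _ _ fun h => rfl
  rw [← hs.gen, Algebra.adjoin_range_eq_range_aeval] at hF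
  obtain ⟨Q, hQ⟩ := hF
  have hQ' : ∀ z, eval z F = eval (pMap p z) Q := fun z => by
    rw [← hQ]; exact eval_aeval z p Q
  have h0 : eval x F = 0 := by
    rw [map_prod]
    refine Finset.prod_eq_zero (i := (1 : G)) (Finset.mem_univ _) ?_
    rw [Subgroup.coe_one, matAct_one, eval_sqDist_eq_zero]
  rw [hQ', h, ← hQ', map_prod, Finset.prod_eq_zero_iff] at h0
  obtain ⟨g, -, hg⟩ := h0
  rw [eval_matAct, eval_sqDist_eq_zero] at hg
  refine ⟨g, g.2, ?_⟩
  rw [← hg, Matrix.mulVec_mulVec, ← Units.val_mul, mul_inv_cancel, Units.val_one,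
    Matrix.one_mulVec]

end quotient

section descent

/-- A cocycle whose sums over the nontrivial fibres of `ρ` vanish on the kernel of `ρ` induces an
inversion cocycle of the quotient. -/
theorem IsInversionCocycle.exists_quotient {W H : Type*} [Group W] [Group H] [Finite W]
    {S T : Set W} {N : W → W → ZMod 2} (hN : IsInversionCocycle S N) (hST : S ⊆ T)
    (hT : ∀ t ∈ T, ∀ w, w * t * w⁻¹ ∈ T) {ρ : W →* H} (hρ : Function.Surjective ρ)
    (h0 : ∀ g, ρ g = 1 → ∀ r, r ≠ 1 → ∀ F : Finset W, (∀ t, t ∈ F ↔ t ∈ T ∧ ρ t = r) →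
      ∑ t ∈ F, N g t = 0) :
    ∃ N' : H → H → ZMod 2, IsInversionCocycle {h | h ≠ 1 ∧ ∃ s ∈ S, ρ s = h} N' := by
  classical
  have := Fintype.ofFinite W
  let F : H → Finset W := fun r => Finset.univ.filter fun t => t ∈ T ∧ ρ t = r
  have hF : ∀ r t, t ∈ F r ↔ t ∈ T ∧ ρ t = r := fun r t => by simp [F]
  let M : W → H → ZMod 2 := fun w r => if r = 1 then 0 else ∑ t ∈ F r, N w t
  have hM1 : ∀ w, M w 1 = 0 := fun w => if_pos rfl
  have hM : ∀ w r, r ≠ 1 → M w r = ∑ t ∈ F r, N w t := fun w r hr => if_neg hr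
  have hmul : ∀ x y r, M (x * y) r = M x r + M y ((ρ x)⁻¹ * r * ρ x) := by
    intro x y r
    by_cases hr : r = 1
    · simp [hr, hM1]
    have hr' : (ρ x)⁻¹ * r * ρ x ≠ 1 := fun h => hr (by
      rw [show r = ρ x * ((ρ x)⁻¹ * r * ρ x) * (ρ x)⁻¹ by group, h]; group)
    rw [hM _ _ hr, hM _ _ hr, hM _ _ hr', Finset.sum_congr rfl fun t _ => hN.mul x y t,
      Finset.sum_add_distrib]
    congr 1
    refine Finset.sum_bij' (fun t _ => x⁻¹ * t * x) (fun t _ => x * t * x⁻¹) ?_ ?_ ?_ ?_ ?_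
    · intro t ht
      rw [hF] at ht ⊢
      refine ⟨by simpa using hT t ht.1 x⁻¹, by simp [ht.2]⟩
    · intro t ht
      rw [hF] at ht ⊢
      refine ⟨hT t ht.1 x, by simp [ht.2, mul_assoc]⟩
    · intro t _; group
    · intro t _; group
    · intro t _; rfl
  have hker : ∀ g r, ρ g = 1 → M g r = 0 := by
    intro g r hg
    by_cases hr : r = 1
    · rw [hr, hM1]
    · rw [hM _ _ hr]; exact h0 g hg r hr _ (hF r)
  have hfib : ∀ x y r, ρ x = ρ y → M x r = M y r := by
    intro x y r hxy
    have := hmul y (y⁻¹ * x) r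
    rwa [mul_inv_cancel_left, hker (y⁻¹ * x) _ (by simp [hxy]), add_zero] at this
  let l := Function.surjInv hρ
  have hl : ∀ h, ρ (l h) = h := Function.surjInv_eq hρ
  refine ⟨fun h r => M (l h) r, fun x y r => ?_, ?_, ?_⟩
  · have := hmul (l x) (l y) r
    rw [hl] at this
    rw [← this]
    exact hfib _ _ _ (by rw [hl, map_mul, hl, hl])
  · rintro _ ⟨hne, s, hs, rfl⟩
    rw [hfib _ s _ (hl _), hM _ _ hne, Finset.sum_eq_single s, hN.simple_self s hs]
    · exact fun t _ hts => hN.simple_ne s hs t hts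
    · exact fun h => absurd ((hF _ _).2 ⟨hST hs, rfl⟩) h
  · rintro _ ⟨hne, s, hs, rfl⟩ r hr
    rw [hfib _ s _ (hl _)]
    by_cases hr1 : r = 1
    · rw [hr1, hM1]
    · rw [hM _ _ hr1]
      refine Finset.sum_eq_zero fun t ht => hN.simple_ne s hs t ?_
      rintro rfl
      exact hr ((hF _ _).1 ht).2.symm

end descent

namespace IsOrthogonalReflectionRep

variable {W V : Type*} [Group W] [AddCommGroup V] [Module ℝ V] {π : W →* (V →ₗ[ℝ] V)}
  {B : V →ₗ[ℝ] V →ₗ[ℝ] ℝ} {T : Set W}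

/-- The stabilizer of a point on the segment from `z` to `σ z` is contained in `{1, σ}`. -/
theorem eq_one_or_eq_of_apply_segment [Finite W] (h : IsOrthogonalReflectionRep π B T) {z : V}
    (hz : IsRegularVector π T z) {σ : W} (hσ : σ ∈ wallReflections π B T z) {s : ℝ}
    (hs0 : 0 ≤ s) (hs1 : s ≤ 1) {u : W}
    (hu : π u (z + s • (π σ z - z)) = z + s • (π σ z - z)) : u = 1 ∨ u = σ := by
  have hsub : {t | t ∈ T ∧ π t (z + s • (π σ z - z)) = z + s • (π σ z - z)} ⊆ {σ} := by
    rintro t ⟨ht, htx⟩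
    by_contra hne
    have h1 := hσ.2 t ht hne
    have h2 := h.sideForm_self_pos (hz t ht)
    have h3 : sideForm π B t z (z + s • (π σ z - z)) = 0 := by
      rw [sideForm, htx, sub_self, map_zero]
    have h4 : sideForm π B t z (z + s • (π σ z - z)) =
        (1 - s) * sideForm π B t z z + s * sideForm π B t z (π σ z) := by
      simp only [sideForm, map_add, map_smul, map_sub, smul_eq_mul, LinearMap.sub_apply]; ring
    rw [h4] at h3
    rcases hs0.eq_or_lt with rfl | hs
    · simp at h3; linarith
    · nlinarith [mul_pos hs h1, mul_nonneg (sub_nonneg.2 hs1) h2.le]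
  have hmem := Subgroup.closure_mono hsub (h.mem_closure_of_apply_eq hu)
  rw [Subgroup.mem_closure_singleton] at hmem
  obtain ⟨k, rfl⟩ := hmem
  have hσ2 : σ ^ 2 = 1 := by rw [sq]; exact h.mul_self hσ.1
  rcases Int.even_or_odd' k with ⟨j, rfl | rfl⟩
  · left; rw [zpow_mul]; simp [hσ2]
  · right; rw [zpow_add, zpow_mul]; simp [hσ2]

open Classical in
/-- If `P` is a function changing sign exactly across the mirrors of the reflections above `r`,
the number of these mirrors separating `z` from `w z` is controlled by the signs of `P`. -/
theorem sum_separates_eq [Finite W] (h : IsOrthogonalReflectionRep π B T) {z : V}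
    (hz : IsRegularVector π T z) {H : Type*} [Group H] {ρ : W →* H} {r : H} (hr : r ≠ 1)
    {P : V → ℝ} (hcont : ∀ x y, Continuous fun s : ℝ => P (x + s • y))
    (hneg : ∀ t ∈ T, ρ t = r → ∀ x, P (π t x) = -P x)
    (hzero : ∀ x, P x = 0 → ∃ w, π w x = x ∧ ρ w = r)
    {F : Finset W} (hF : ∀ t, t ∈ F ↔ t ∈ T ∧ ρ t = r) (w : W) :
    ∑ t ∈ F, separates π B T z w t =
      (if P (π w z) < 0 then 1 else 0) + if P z < 0 then 1 else 0 := by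
  have hne : ∀ w, P (π w z) ≠ 0 := by
    intro w hw
    obtain ⟨u, hu, hur⟩ := hzero _ hw
    have h1 := h.mem_closure_of_apply_eq hu
    rw [show {t | t ∈ T ∧ π t (π w z) = π w z} = ∅ from
      Set.eq_empty_of_forall_notMem fun t ht => h.isRegularVector_apply hz w t ht.1 ht.2,
      Subgroup.closure_empty, Subgroup.mem_bot] at h1
    rw [h1, map_one] at hur
    exact hr hur.symm
  have hN := h.separates_isInversionCocycle hz
  have hstep : ∀ w, ∀ σ ∈ wallReflections π B T z,
      ∑ t ∈ F, separates π B T z w t =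
        (if P (π w z) < 0 then 1 else 0) + (if P z < 0 then 1 else 0) →
      ∑ t ∈ F, separates π B T z (w * σ) t =
        (if P (π (w * σ) z) < 0 then 1 else 0) + if P z < 0 then 1 else 0 := by
    intro w σ hσ ih
    have hsum : ∑ t ∈ F, separates π B T z σ (w⁻¹ * t * w) =
        if ρ (w * σ * w⁻¹) = r then 1 else 0 := by
      have h1 : ∀ t, t ≠ w * σ * w⁻¹ → separates π B T z σ (w⁻¹ * t * w) = 0 := by
        intro t ht
        refine hN.simple_ne σ hσ _ fun h => ht ?_
        rw [← h]; group
      split_ifs with hw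
      · rw [Finset.sum_eq_single (w * σ * w⁻¹)]
        · rw [show w⁻¹ * (w * σ * w⁻¹) * w = σ by group, hN.simple_self σ hσ]
        · exact fun t _ ht => h1 t ht
        · exact fun hnot => absurd ((hF _).2 ⟨h.conj_mem σ hσ.1 w, hw⟩) hnot
      · refine Finset.sum_eq_zero fun t ht => h1 t ?_
        rintro rfl
        exact hw ((hF _).1 ht).2
    simp only [hN.mul w σ, Finset.sum_add_distrib, ih, hsum]
    have hconj : π (w * σ) z = π (w * σ * w⁻¹) (π w z) := by
      rw [← map_mul_apply, inv_mul_cancel_right]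
    by_cases hw : ρ (w * σ * w⁻¹) = r
    · rw [if_pos hw, hconj, hneg _ (h.conj_mem σ hσ.1 w) hw]
      rcases (hne w).lt_or_gt with h1 | h1
      · rw [if_pos h1, if_neg (neg_pos.2 h1).not_gt]; split_ifs <;> decide
      · rw [if_neg h1.not_gt, if_pos (neg_neg_of_pos h1)]; split_ifs <;> decide
    · have hseg : ∀ s ∈ Set.uIcc (0 : ℝ) 1, P (π w z + s • π w (π σ z - z)) ≠ 0 := by
        intro s hs h0
        rw [Set.uIcc_of_le zero_le_one] at hs
        obtain ⟨u, hu, hur⟩ := hzero _ h0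
        rw [← map_smul, ← map_add] at hu
        have h2 : π (w⁻¹ * u * w) (z + s • (π σ z - z)) = z + s • (π σ z - z) := by
          rw [map_mul_apply, map_mul_apply, hu, map_inv_apply_self]
        rcases h.eq_one_or_eq_of_apply_segment hz hσ hs.1 hs.2 h2 with h3 | h3
        · refine hr (hur.symm.trans ?_)
          rw [show u = w * (w⁻¹ * u * w) * w⁻¹ by group, h3]; simp
        · refine hw ?_
          rw [← h3, ← hur]; congr 1; group
      have hiff : P (π (w * σ) z) < 0 ↔ P (π w z) < 0 := by
        have h1 := intermediate_value_uIcc (a := (0 : ℝ)) (b := 1)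
          (hcont (π w z) (π w (π σ z - z))).continuousOn
        have h0 : (0 : ℝ) ∉ Set.uIcc (P (π w z + (0 : ℝ) • π w (π σ z - z)))
            (P (π w z + (1 : ℝ) • π w (π σ z - z))) := fun h0 => by
          obtain ⟨s, hs, hs0⟩ := h1 h0
          exact hseg s hs hs0
        rw [zero_smul, add_zero, one_smul, map_sub, add_sub_cancel, ← map_mul_apply,
          Set.mem_uIcc] at h0
        grind
      rw [if_neg hw, add_zero, if_congr hiff rfl rfl]
  have hmem : w ∈ Subgroup.closure (wallReflections π B T z) := by
    rw [h.closure_wallReflections hz]; trivial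
  induction hmem using Subgroup.closure_induction_right with
  | one =>
    rw [map_one, Module.End.one_apply, CharTwo.add_self_eq_zero]
    exact Finset.sum_eq_zero fun t _ => if_neg fun h0 => by
      have := h.nonneg (z - π t z)
      rw [map_one] at h0
      exact this.not_gt h0.2
  | mul_right x _ σ hσ ih => exact hstep x σ hσ ih
  | mul_inv_cancel x _ σ hσ ih =>
    rw [h.inv_eq hσ.1]; exact hstep x σ hσ ih

end IsOrthogonalReflectionRep

section reflectionRep

variable {n m : ℕ}

/-- The natural representation of a matrix group. -/
def naturalRep (Wt : Subgroup (Matrix.GeneralLinearGroup (Fin n) ℝ)) :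
    ↥Wt →* ((Fin n → ℝ) →ₗ[ℝ] (Fin n → ℝ)) where
  toFun w := Matrix.toLin' (matOf w)
  map_one' := Matrix.toLin'_one
  map_mul' x y := Matrix.toLin'_mul (matOf x) (matOf y)

@[simp]
theorem naturalRep_apply {Wt : Subgroup (Matrix.GeneralLinearGroup (Fin n) ℝ)} (w : ↥Wt)
    (x : Fin n → ℝ) : naturalRep Wt w x = (matOf w).mulVec x := rfl

/-- The average of the standard scalar product over a finite matrix group. -/
def averageForm (Wt : Subgroup (Matrix.GeneralLinearGroup (Fin n) ℝ)) [Fintype Wt] :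
    (Fin n → ℝ) →ₗ[ℝ] (Fin n → ℝ) →ₗ[ℝ] ℝ :=
  ∑ w : Wt, (dotProductBilin ℝ ℝ).compl₁₂ (naturalRep Wt w) (naturalRep Wt w)

theorem averageForm_apply {Wt : Subgroup (Matrix.GeneralLinearGroup (Fin n) ℝ)} [Fintype Wt]
    (x y : Fin n → ℝ) :
    averageForm Wt x y = ∑ w : Wt, dotProduct (naturalRep Wt w x) (naturalRep Wt w y) := by
  simp [averageForm, LinearMap.sum_apply, dotProductBilin]

theorem exists_root {V : Type*} [AddCommGroup V] [Module ℝ V] {B : V →ₗ[ℝ] V →ₗ[ℝ] ℝ}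
    (hpos : ∀ x, x ≠ 0 → 0 < B x x) {t : V →ₗ[ℝ] V} (hB : ∀ x y, B (t x) (t y) = B x y)
    (ht : ∀ x, t (t x) = x) {b y : V} (hb : b ≠ 0) (hy : b = y - t y)
    (h : ∀ x, ∃ k : ℝ, x - t x = k • b) : ∃ a, B a a = 2 ∧ ∀ x, t x = x - B x a • a := by
  have hb0 := hpos b hb
  have htb : t b = -b := by rw [hy, map_sub, ht, neg_sub]
  have hk : ∀ x, x - t x = (2 * B x b / B b b) • b := by
    intro x
    obtain ⟨k, hk⟩ := h x
    have h1 : B (x - t x) b = 2 * B x b := by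
      have h2 := hB x b
      rw [htb, map_neg] at h2
      rw [map_sub, LinearMap.sub_apply]; linarith
    rw [hk, map_smul, LinearMap.smul_apply, smul_eq_mul] at h1
    rw [hk, ← h1, mul_div_cancel_right₀ _ hb0.ne']
  have hsq : Real.sqrt (2 / B b b) * Real.sqrt (2 / B b b) = 2 / B b b :=
    Real.mul_self_sqrt (by positivity)
  refine ⟨Real.sqrt (2 / B b b) • b, ?_, fun x => ?_⟩
  · simp only [map_smul, LinearMap.smul_apply, smul_eq_mul]
    rw [← mul_assoc, hsq, div_mul_cancel₀ _ hb0.ne']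
  · rw [eq_sub_iff_add_eq', ← eq_sub_iff_add_eq, hk x, map_smul, smul_eq_mul, smul_smul]
    congr 1
    rw [mul_right_comm, hsq]; ring

theorem isOrthogonalReflectionRep_naturalRep
    {Wt : Subgroup (Matrix.GeneralLinearGroup (Fin n) ℝ)} [Fintype Wt] {S : Set ↥Wt}
    (hS : ∀ s ∈ S, IsReflection (matOf s)) (hinv : ∀ s ∈ S, s * s = 1)
    (hgen : Subgroup.closure S = ⊤) :
    IsOrthogonalReflectionRep (naturalRep Wt) (averageForm Wt)
      {t | ∃ v, ∃ s ∈ S, t = v * s * v⁻¹} := by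
  have hinvar : ∀ (w : ↥Wt) (x y : Fin n → ℝ),
      averageForm Wt (naturalRep Wt w x) (naturalRep Wt w y) = averageForm Wt x y := by
    intro w x y
    rw [averageForm_apply, averageForm_apply]
    refine Fintype.sum_equiv (Equiv.mulRight w) _ _ fun u => ?_
    simp only [Equiv.coe_mulRight, map_mul]; rfl
  have hpos : ∀ x : Fin n → ℝ, x ≠ 0 → 0 < averageForm Wt x x := by
    intro x hx
    rw [averageForm_apply]
    refine Finset.sum_pos' (fun w _ => Finset.sum_nonneg fun i _ => mul_self_nonneg _)
      ⟨1, Finset.mem_univ _, ?_⟩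
    rw [map_one, Module.End.one_apply]
    exact lt_of_le_of_ne (Finset.sum_nonneg fun i _ => mul_self_nonneg _)
      (Ne.symm fun h => hx (dotProduct_self_eq_zero.1 h))
  refine ⟨fun x y => ?_, hpos, hinvar, fun x y h => ?_, ?_, ?_, ?_⟩
  · rw [averageForm_apply, averageForm_apply]
    exact Finset.sum_congr rfl fun w _ => dotProduct_comm _ _
  · exact Subtype.ext (Units.ext (Matrix.toLin'.injective h))
  · rintro _ ⟨v, s, hs, rfl⟩ w
    exact ⟨w * v, s, hs, by group⟩
  · rintro _ ⟨v, s, hs, rfl⟩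
    have hss : ∀ x, naturalRep Wt s (naturalRep Wt s x) = x := fun x => by
      rw [← IsOrthogonalReflectionRep.map_mul_apply, hinv s hs, map_one]; rfl
    obtain ⟨a, ha, hsa⟩ : ∃ a, averageForm Wt a a = 2 ∧
        ∀ x, naturalRep Wt s x = x - averageForm Wt x a • a := by
      set f := naturalRep Wt s - LinearMap.id with hf
      have hrank : Module.finrank ℝ (LinearMap.range f) = 1 := by
        have h1 := f.finrank_range_add_finrank_ker
        have h2 : Module.finrank ℝ (LinearMap.ker f) + 1 = n := (hS s hs).2
        rw [Module.finrank_fin_fun] at h1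
        omega
      obtain ⟨⟨b, y, hy⟩, hb, hspan⟩ := finrank_eq_one_iff'.1 hrank
      refine exists_root hpos (hinvar s) hss (b := b) (y := -y)
        (fun h0 => hb (Subtype.ext h0)) ?_ fun x => ?_
      · rw [← hy, hf, map_neg, LinearMap.sub_apply, LinearMap.id_apply]; abel
      · obtain ⟨k, hk⟩ := hspan ⟨f (-x), _, rfl⟩
        refine ⟨k, ?_⟩
        have hk' : k • b = f (-x) := congrArg Subtype.val hk
        rw [hk', hf, map_neg, LinearMap.sub_apply, LinearMap.id_apply]; abel
    refine ⟨naturalRep Wt v a, by rw [hinvar, ha], fun x => ?_⟩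
    rw [IsOrthogonalReflectionRep.map_mul_apply, IsOrthogonalReflectionRep.map_mul_apply, hsa,
      map_sub, map_smul, IsOrthogonalReflectionRep.map_apply_inv_self, ← hinvar v,
      IsOrthogonalReflectionRep.map_apply_inv_self]
  · rw [eq_top_iff, ← hgen]
    exact Subgroup.closure_mono fun s hs => ⟨1, s, hs, by group⟩

variable {Wt G : Subgroup (Matrix.GeneralLinearGroup (Fin n) ℝ)}
  {p : Fin m → MvPolynomial (Fin n) ℝ} {d : Fin m → ℕ} {c : ↥Wt → Fin m → Fin m → ℝ}

/-- A function on `V~`, pulled back from a linear form on `V`, that changes sign under the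
reflections above a given element of the quotient and vanishes exactly on their mirrors and the
translates of these by `G`. -/
theorem QuotSetup.exists_signFunction (hs : QuotSetup Wt G p d c) (htriv : TrivialConormal Wt p c)
    {B : (Fin n → ℝ) →ₗ[ℝ] (Fin n → ℝ) →ₗ[ℝ] ℝ} {T : Set ↥Wt}
    (h : IsOrthogonalReflectionRep (naturalRep Wt) B T) {z : Fin n → ℝ}
    (hz : IsRegularVector (naturalRep Wt) T z)
    (hq : ∀ x y, qMat c (x * y) = qMat c x * qMat c y) {H : Type*} [Group H] {ρ : ↥Wt →* H}
    (hρ : ∀ x y, ρ x = ρ y ↔ qMat c x = qMat c y) {t₀ : ↥Wt} (ht₀ : t₀ ∈ T) (hρt₀ : ρ t₀ ≠ 1) :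
    ∃ P : (Fin n → ℝ) → ℝ, Continuous P ∧
      (∀ t ∈ T, ρ t = ρ t₀ → ∀ x, P (naturalRep Wt t x) = -P x) ∧
      (∀ x, P x = 0 → ∃ w, naturalRep Wt w x = x ∧ ρ w = ρ t₀) ∧
      ∀ g, ρ g = 1 → ∀ x, P (naturalRep Wt g x) = P x := by
  have : Finite ↥Wt := hs.finite.to_subtype
  have hq1 : qMat c 1 = 1 := hs.qMat_eq_one (one_mem G)
  obtain ⟨v, -, hσ⟩ := h.exists_conj_mem_wallReflections hz ht₀
  set σ := v * t₀ * v⁻¹ with hσdef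
  have hσσ := h.mul_self hσ.1
  have hRR : qMat c σ * qMat c σ = 1 := by rw [← hq, hσσ, hq1]
  have hGρ : ∀ g : ↥Wt, (g : Matrix.GeneralLinearGroup (Fin n) ℝ) ∈ G → ρ g = 1 := fun g hg => by
    rw [← map_one ρ, hρ, hq1, hs.qMat_eq_one hg]
  obtain ⟨a, -, ha⟩ := h.refl σ hσ.1
  have hfix : naturalRep Wt σ (z + (1 / 2 : ℝ) • (naturalRep Wt σ z - z)) =
      z + (1 / 2 : ℝ) • (naturalRep Wt σ z - z) := by
    rw [map_add, map_smul, map_sub, h.apply_apply hσ.1]; module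
  obtain ⟨v₀, hv₀⟩ := hs.exists_eq_smul_of_mulVec_eq_neg htriv hσσ hRR (a := a)
    (fun u => ⟨B u a, by rw [← naturalRep_apply, ha]; module⟩) hfix (fun g hg hgx => by
      rcases h.eq_one_or_eq_of_apply_segment hz hσ (s := 1 / 2) (by norm_num) (by norm_num)
        (u := ⟨g, hs.le hg⟩) hgx with h1 | h1
      · exact congrArg Subtype.val h1
      · refine absurd ?_ hρt₀
        have h2 := hGρ ⟨g, hs.le hg⟩ hg
        rw [h1, hσdef] at h2
        simpa using h2)
  obtain ⟨f, hf, hf0⟩ := exists_linearMap_neg (R := Matrix.toLin' (qMat c σ))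
    (fun y => by
      rw [Matrix.toLin'_apply, Matrix.toLin'_apply, Matrix.mulVec_mulVec, hRR, Matrix.one_mulVec])
    hv₀
  have heq : ∀ u u' x, ρ u = ρ u' →
      pMap p (naturalRep Wt u x) = pMap p (naturalRep Wt u' x) := fun u u' x hu => by
    rw [naturalRep_apply, naturalRep_apply, hs.pMap_mulVec, hs.pMap_mulVec, (hρ _ _).1 hu]
  refine ⟨fun x => f (pMap p (naturalRep Wt v x)), ?_, fun t _ htr x => ?_, fun x hx => ?_,
    fun g hg x => ?_⟩
  · exact f.continuous_of_finiteDimensional.comp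
      (continuous_pMap.comp (naturalRep Wt v).continuous_of_finiteDimensional)
  · dsimp only
    rw [← hf, Matrix.toLin'_apply, ← hs.pMap_mulVec, ← naturalRep_apply,
      ← IsOrthogonalReflectionRep.map_mul_apply, ← IsOrthogonalReflectionRep.map_mul_apply,
      heq _ (σ * v) x]
    simp [hσdef, htr]
  · have h1 := hf0 _ hx
    rw [Matrix.toLin'_apply, ← hs.pMap_mulVec, ← naturalRep_apply] at h1
    obtain ⟨g, hg, hgx⟩ := hs.exists_mulVec_eq_of_pMap_eq h1
    set g' : ↥Wt := ⟨g, hs.le hg⟩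
    have h2 : naturalRep Wt g' (naturalRep Wt σ (naturalRep Wt v x)) = naturalRep Wt v x := hgx
    refine ⟨v⁻¹ * (g' * (σ * v)), ?_, ?_⟩
    · simp only [IsOrthogonalReflectionRep.map_mul_apply]
      rw [h2, IsOrthogonalReflectionRep.map_inv_apply_self]
    · rw [map_mul, map_mul, hGρ g' hg, one_mul, hσdef, ← map_mul]; congr 1; group
  · dsimp only
    rw [← IsOrthogonalReflectionRep.map_mul_apply, heq _ v x (by rw [map_mul, hg, mul_one])]

end reflectionRep

/-- suppose `k = ℝ`, `(Wt, St)` is a Coxeter system (with `St` a set of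
reflections), and `G` is a good normal subgroup of `Wt`. Let `S` be the set of
non-identity elements of the image of `St` in `W = Wt/G` (realized as the image of the
induced homomorphism `ρ : Wt → GL(V)`). Then `(W, S)` is a Coxeter system. -/
theorem statement8 {n m : ℕ}
    (Wt G : Subgroup (Matrix.GeneralLinearGroup (Fin n) ℝ))
    (p : Fin m → MvPolynomial (Fin n) ℝ) (d : Fin m → ℕ)
    (c : ↥Wt → Fin m → Fin m → ℝ)
    (hsetup : QuotSetup Wt G p d c)
    (hgood : IsGoodQuot Wt p c)
    (St : Set ↥Wt)
    (hSrefl : ∀ s ∈ St, IsReflection (matOf s))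
    (B0 : Type) (M0 : CoxeterMatrix B0) (cs : CoxeterSystem M0 ↥Wt)
    (hS : Set.range cs.simple = St) :
    ∀ ρ : ↥Wt →* Matrix.GeneralLinearGroup (Fin m) ℝ,
      (∀ (w : ↥Wt) (i j : Fin m),
        ((ρ w : Matrix.GeneralLinearGroup (Fin m) ℝ) : Matrix (Fin m) (Fin m) ℝ) i j
          = qMat c w i j) →
      ∃ (B1 : Type) (M1 : CoxeterMatrix B1)
        (cs1 : CoxeterSystem M1 ↥(MonoidHom.range ρ)),
        Set.range cs1.simple =
          {w : ↥(MonoidHom.range ρ) |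
            (w : Matrix.GeneralLinearGroup (Fin m) ℝ) ≠ 1 ∧ ∃ s ∈ St, ρ s = ↑w} := by
  intro ρ hρ
  have : Finite ↥Wt := hsetup.finite.to_subtype
  have := Fintype.ofFinite ↥Wt
  have hρq : ∀ w, ((ρ w : Matrix.GeneralLinearGroup (Fin m) ℝ) : Matrix (Fin m) (Fin m) ℝ) =
      qMat c w := fun w => Matrix.ext (hρ w)
  have hq : ∀ x y, qMat c (x * y) = qMat c x * qMat c y := fun x y => by
    rw [← hρq, ← hρq, ← hρq, map_mul, Units.val_mul]
  have hρ' : ∀ x y, ρ.rangeRestrict x = ρ.rangeRestrict y ↔ qMat c x = qMat c y := fun x y => by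
    rw [← hρq, ← hρq, Units.val_inj, Subtype.ext_iff]; rfl
  have hsurj : Function.Surjective ρ.rangeRestrict := ρ.rangeRestrict_surjective
  have hinv : ∀ s ∈ St, s * s = 1 := by
    rw [← hS]
    rintro _ ⟨i, rfl⟩
    exact cs.simple_mul_simple_self i
  have hgen : Subgroup.closure St = ⊤ := by rw [← hS, cs.subgroup_closure_range_simple]
  have h := isOrthogonalReflectionRep_naturalRep hSrefl hinv hgen
  obtain ⟨z, hz⟩ := h.exists_isRegularVector
  obtain ⟨N, hN⟩ := exists_isInversionCocycle cs
  rw [hS] at hN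
  obtain ⟨N', hN'⟩ := hN.exists_quotient
    (T := {t | ∃ v, ∃ s ∈ St, t = v * s * v⁻¹}) (fun s hs => ⟨1, s, hs, by group⟩)
    h.conj_mem hsurj (by
    intro g hg r hr F hF
    rcases F.eq_empty_or_nonempty with rfl | ⟨t₀, ht₀⟩
    · exact Finset.sum_empty
    obtain ⟨ht₀T, rfl⟩ := (hF t₀).1 ht₀
    obtain ⟨P, hPc, hPneg, hP0, hPg⟩ :=
      hsetup.exists_signFunction hgood.2 h hz hq hρ' ht₀T hr
    rw [h.sum_cocycle_eq_sum_separates hz hN (fun t ht => ht) _ _ hg hF,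
      h.sum_separates_eq hz hr (fun x y => hPc.comp (by fun_prop)) hPneg hP0 hF, hPg g hg,
      CharTwo.add_self_eq_zero])
  obtain ⟨B1, M1, cs1, hcs1⟩ := hN'.exists_coxeterSystem
    (by
      rintro _ ⟨-, s, hs, rfl⟩
      rw [← map_mul, hinv s hs, map_one])
    (by
      rw [eq_top_iff, ← Subgroup.map_top_of_surjective _ hsurj, ← hgen, MonoidHom.map_closure,
        Subgroup.closure_le]
      rintro _ ⟨s, hs, rfl⟩
      by_cases h1 : ρ.rangeRestrict s = 1
      · rw [h1]; exact one_mem _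
      · exact Subgroup.subset_closure ⟨h1, s, hs, rfl⟩)
  refine ⟨B1, M1, cs1, hcs1.trans ?_⟩
  ext w
  constructor
  · rintro ⟨h1, s, hs, e⟩
    exact ⟨fun h => h1 (Subtype.ext h), s, hs, congrArg Subtype.val e⟩
  · rintro ⟨h1, s, hs, e⟩
    exact ⟨fun h => h1 (congrArg Subtype.val h), s, hs, Subtype.ext e⟩
end ReflQuot
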